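/- The number of minimum weight codewords of the code C_2(X) equals (t^2 - 1) · (1/2) · (t^5 + t^3 + t^2 + 1) · t^5. -/

import Mathlib

open LinearAlgebra.Projectivization Projectivization Finset

/-- The Hermitian surface in `PG(3,q)`, `q = t²`. -/
def hermSurf (t : ℕ) (F : Type) [Field F] : Set (ℙ F (Fin 4 → F)) :=
  {x | ∑ i : Fin 4, (x.rep i) ^ (t + 1) = 0}

/-- The tangent plane to the Hermitian surface at a point `P`, given by the
Hermitian polarity `∑ xᵢ · (Pᵢ)^t = 0`. -/
def hermTangentPlane (t : ℕ) (F : Type) [Field F] (P : ℙ F (Fin 4 → F)) :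
    Set (ℙ F (Fin 4 → F)) :=
  {x | ∑ i : Fin 4, x.rep i * (P.rep i) ^ t = 0}

/-- The set of projective points of a linear subspace `W` (a plane if
`finrank W = 3`, a line if `finrank W = 2`). -/
def projSet (F : Type) [Field F] (W : Submodule F (Fin 4 → F)) : Set (ℙ F (Fin 4 → F)) :=
  {x | x.submodule ≤ W}
/-- Evaluation of polynomials at the (fixed) representatives of the points of the
Hermitian surface, as a linear map. -/
noncomputable def hermEval (t : ℕ) (F : Type) [Field F] :
    MvPolynomial (Fin 4) F →ₗ[F] (↥(hermSurf t F) → F) where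
  toFun f := fun x => MvPolynomial.eval (x : ℙ F (Fin 4 → F)).rep f
  map_add' f g := by funext x; simp
  map_smul' c f := by funext x; simp

/-- The functional code `C_h(X)` of degree-`h` forms on the Hermitian surface. -/
noncomputable def hermCode (t : ℕ) (F : Type) [Field F] (h : ℕ) : Submodule F (↥(hermSurf t F) → F) :=
  (MvPolynomial.homogeneousSubmodule (Fin 4) F h).map (hermEval t F)

/-- The weight of a codeword: the number of nonzero coordinates. -/
noncomputable def wt (t : ℕ) (F : Type) [Field F] (c : ↥(hermSurf t F) → F) : ℕ :=
  Nat.card {x : ↥(hermSurf t F) // c x ≠ 0}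
section GeneralizedQuadrangle

open scoped Classical Finset

/-- Two points are collinear when some line of the family contains both. -/
def Coll {P : Type*} (lines : Finset (Finset P)) (x y : P) : Prop :=
  ∃ l ∈ lines, x ∈ l ∧ y ∈ l

/-- A finite generalized quadrangle of order `(t², t)`. -/
structure GenQuad (P : Type*) [Fintype P] (t : ℕ) where
  lines : Finset (Finset P)
  card_points : Fintype.card P = (t ^ 2 + 1) * (t ^ 3 + 1)
  card_line : ∀ l ∈ lines, #l = t ^ 2 + 1
  card_pencil : ∀ p : P, #{l ∈ lines | p ∈ l} = t + 1
  eq_of_mem : ∀ l ∈ lines, ∀ m ∈ lines, ∀ p r : P, p ≠ r →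
    p ∈ l → r ∈ l → p ∈ m → r ∈ m → l = m
  exists_proj : ∀ l ∈ lines, ∀ p : P, ∃ r ∈ l, Coll lines p r
  proj_unique : ∀ l ∈ lines, ∀ p ∉ l, ∀ r ∈ l, ∀ r' ∈ l,
    Coll lines p r → Coll lines p r' → r = r'

lemma Coll.symm {P : Type*} {lines : Finset (Finset P)} {x y : P} (h : Coll lines x y) :
    Coll lines y x := by
  obtain ⟨l, hl, hx, hy⟩ := h
  exact ⟨l, hl, hy, hx⟩

namespace GenQuad

variable {P : Type*} [Fintype P] {t : ℕ} (G : GenQuad P t)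

/-- The points collinear with `p`. -/
noncomputable def perp (p : P) : Finset P := {x | Coll G.lines p x}

/-- The lines through `p`. -/
noncomputable def pencil (p : P) : Finset (Finset P) := {l ∈ G.lines | p ∈ l}

lemma mem_perp {p x : P} : x ∈ G.perp p ↔ Coll G.lines p x := by simp [perp]

lemma mem_pencil {p : P} {l : Finset P} : l ∈ G.pencil p ↔ l ∈ G.lines ∧ p ∈ l := by
  simp [pencil]

lemma coll_self (p : P) : Coll G.lines p p := by
  have h : 0 < #(G.pencil p) := by
    have := G.card_pencil p
    unfold pencil
    omega
  obtain ⟨l, hl⟩ := Finset.card_pos.mp h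
  rw [mem_pencil] at hl
  exact ⟨l, hl.1, hl.2, hl.2⟩

/-- The sets `S ∩ m \ {p}`, for `m` a line through `p`, partition `S ∩ p^⊥ \ {p}`. -/
lemma card_inter_perp_erase (S : Finset P) (p : P) :
    #((S ∩ G.perp p).erase p) = ∑ m ∈ G.pencil p, #((S ∩ m).erase p) := by
  rw [← Finset.card_biUnion]
  · congr 1
    ext x
    simp only [Finset.mem_erase, Finset.mem_inter, Finset.mem_biUnion, mem_perp, mem_pencil]
    constructor
    · rintro ⟨h1, h2, l, hl, h3, h4⟩
      exact ⟨l, ⟨hl, h3⟩, h1, h2, h4⟩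
    · rintro ⟨l, ⟨hl, h3⟩, h1, h2, h4⟩
      exact ⟨h1, h2, l, hl, h3, h4⟩
  · intro m hm n hn hmn
    rw [Function.onFun, Finset.disjoint_left]
    intro x hx hx'
    rw [Finset.mem_coe, mem_pencil] at hm hn
    simp only [Finset.mem_erase, Finset.mem_inter] at hx hx'
    exact hmn (G.eq_of_mem m hm.1 n hn.1 x p hx.1 hx.2.2 hm.2 hx'.2.2 hn.2)

lemma card_perp (p : P) : #(G.perp p) = (t + 1) * t ^ 2 + 1 := by
  have h := G.card_inter_perp_erase Finset.univ p
  have h1 : ∑ m ∈ G.pencil p, #((Finset.univ ∩ m).erase p) = (t + 1) * t ^ 2 := by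
    rw [Finset.sum_const_nat (m := t ^ 2), pencil, G.card_pencil]
    intro m hm
    rw [mem_pencil] at hm
    rw [Finset.univ_inter, Finset.card_erase_of_mem hm.2, G.card_line m hm.1]
    rfl
  rw [h1, Finset.univ_inter, Finset.card_erase_of_mem (G.mem_perp.2 (G.coll_self p))] at h
  have : 0 < #(G.perp p) := Finset.card_pos.2 ⟨p, G.mem_perp.2 (G.coll_self p)⟩
  omega

/-- Double counting of the incidences between a point set and all lines. -/
lemma sum_card_inter (S : Finset P) : ∑ l ∈ G.lines, #(S ∩ l) = (t + 1) * #S := by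
  have h := Finset.sum_card_bipartiteAbove_eq_sum_card_bipartiteBelow
    (s := S) (t := G.lines) (fun (x : P) (l : Finset P) => x ∈ l)
  have h1 : ∑ a ∈ S, #(Finset.bipartiteAbove (fun (x : P) (l : Finset P) => x ∈ l) G.lines a)
      = (t + 1) * #S := by
    rw [Finset.sum_const_nat (m := t + 1), mul_comm]
    intro x _
    exact G.card_pencil x
  rw [← h1, h]
  refine Finset.sum_congr rfl fun l _ => ?_
  congr 1

lemma card_lines : #G.lines = (t + 1) * (t ^ 3 + 1) := by
  have h := G.sum_card_inter Finset.univ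
  rw [Finset.sum_const_nat (m := t ^ 2 + 1), Finset.card_univ, G.card_points] at h
  · have : 0 < t ^ 2 + 1 := by positivity
    apply Nat.eq_of_mul_eq_mul_right this
    rw [h]; ring
  · intro l hl
    rw [Finset.univ_inter, G.card_line l hl]

/-- A point set meeting every line in at most `d` points has at most `d (t³ + 1)` points. -/
lemma card_le_of_card_inter_le (S : Finset P) (d : ℕ) (h : ∀ l ∈ G.lines, #(S ∩ l) ≤ d) :
    #S ≤ d * (t ^ 3 + 1) := by
  have h1 := Finset.sum_le_card_nsmul G.lines _ d h
  rw [G.sum_card_inter, card_lines, smul_eq_mul] at h1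
  have : 0 < t + 1 := by positivity
  apply Nat.le_of_mul_le_mul_left _ this
  linarith

lemma mem_of_coll {l : Finset P} (hl : l ∈ G.lines) {x r r' : P} (hr : r ∈ l) (hr' : r' ∈ l)
    (hne : r ≠ r') (h : Coll G.lines x r) (h' : Coll G.lines x r') : x ∈ l := by
  by_contra hx
  exact hne (G.proj_unique l hl x hx r hr r' hr' h h')

lemma perp_inter_perp {l : Finset P} (hl : l ∈ G.lines) {p r : P} (hne : p ≠ r) (hp : p ∈ l)
    (hr : r ∈ l) : G.perp p ∩ G.perp r = l := by
  ext x
  simp only [Finset.mem_inter, mem_perp]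
  exact ⟨fun h => G.mem_of_coll hl hp hr hne h.1.symm h.2.symm,
    fun h => ⟨⟨l, hl, hp, h⟩, ⟨l, hl, hr, h⟩⟩⟩

lemma card_perp_inter_perp_of_not_coll {p r : P} (h : ¬ Coll G.lines p r) :
    #(G.perp p ∩ G.perp r) = t + 1 := by
  have hp : p ∉ G.perp r := fun hp => h (G.mem_perp.1 hp).symm
  have h1 := G.card_inter_perp_erase (G.perp r) p
  rw [Finset.erase_eq_of_notMem (by simp [hp]), Finset.inter_comm,
    Finset.sum_const_nat (m := 1), pencil, G.card_pencil, mul_one] at h1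
  · exact h1
  · intro m hm
    rw [mem_pencil] at hm
    rw [Finset.erase_eq_of_notMem (by simp [hp]), Finset.card_eq_one]
    obtain ⟨y, hy, hry⟩ := G.exists_proj m hm.1 r
    refine ⟨y, ?_⟩
    ext z
    simp only [Finset.mem_inter, mem_perp, Finset.mem_singleton]
    constructor
    · rintro ⟨hz, hzm⟩
      by_contra hne
      exact h ⟨m, hm.1, hm.2, G.mem_of_coll hm.1 hzm hy hne hz hry⟩
    · rintro rfl
      exact ⟨hry, hy⟩

lemma card_perp_union_perp_of_not_coll {p r : P} (h : ¬ Coll G.lines p r) :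
    #(G.perp p ∪ G.perp r) + t = 2 * t ^ 3 + 2 * t ^ 2 + 1 := by
  have h1 := Finset.card_union_add_card_inter (G.perp p) (G.perp r)
  rw [G.card_perp_inter_perp_of_not_coll h, card_perp, card_perp] at h1
  linarith

lemma card_not_coll (p : P) : #{r | ¬ Coll G.lines p r} = t ^ 5 := by
  have h := Finset.card_filter_add_card_filter_not (s := Finset.univ)
    (fun r => Coll G.lines p r)
  have h1 : #{r | Coll G.lines p r} = _ := G.card_perp p
  rw [h1, Finset.card_univ, G.card_points] at h
  linarith

/-- A non-collinear pair of points is determined by the union of its perps. -/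
lemma mem_pair_of_perp_subset (ht : 1 < t) {p p' r' : P}
    (h : G.perp p ⊆ G.perp p' ∪ G.perp r') : p = p' ∨ p = r' := by
  by_contra! hne
  have key : ∀ m ∈ G.pencil p, p' ∈ m ∨ r' ∈ m := by
    intro m hm
    rw [mem_pencil] at hm
    by_contra! hcon
    have hsub : m ⊆ (m ∩ G.perp p') ∪ (m ∩ G.perp r') := by
      intro x hx
      rw [← Finset.inter_union_distrib_left, Finset.mem_inter]
      exact ⟨hx, h (G.mem_perp.2 ⟨m, hm.1, hm.2, hx⟩)⟩
    have hone : ∀ s, s ∉ m → #(m ∩ G.perp s) ≤ 1 := by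
      intro s hs
      rw [Finset.card_le_one]
      intro a ha b hb
      simp only [Finset.mem_inter, mem_perp] at ha hb
      exact G.proj_unique m hm.1 s hs a ha.1 b hb.1 ha.2 hb.2
    have h1 := (Finset.card_le_card hsub).trans (Finset.card_union_le _ _)
    rw [G.card_line m hm.1] at h1
    have h2 := hone p' hcon.1
    have h3 := hone r' hcon.2
    nlinarith
  have hone : ∀ s, p ≠ s → #{m ∈ G.pencil p | s ∈ m} ≤ 1 := by
    intro s hs
    rw [Finset.card_le_one]
    intro a ha b hb
    simp only [Finset.mem_filter, mem_pencil] at ha hb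
    exact G.eq_of_mem a ha.1.1 b hb.1.1 p s hs ha.1.2 ha.2 hb.1.2 hb.2
  have hsub : G.pencil p ⊆ {m ∈ G.pencil p | p' ∈ m} ∪ {m ∈ G.pencil p | r' ∈ m} := by
    intro m hm
    rw [← Finset.filter_or, Finset.mem_filter]
    exact ⟨hm, key m hm⟩
  have h1 := (Finset.card_le_card hsub).trans (Finset.card_union_le _ _)
  have h2 := hone p' hne.1
  have h3 := hone r' hne.2
  have h4 : #(G.pencil p) = t + 1 := G.card_pencil p
  omega

section Intersection

variable {Z : Finset P}

/-- `Z \ l` is partitioned by the projections of its points to the line `l`. -/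
lemma card_eq_sum_sdiff {l : Finset P} (hl : l ∈ G.lines) (hlZ : l ⊆ Z) :
    #Z = t ^ 2 + 1 + ∑ p ∈ l, #((Z ∩ G.perp p) \ l) := by
  rw [← Finset.card_biUnion, ← G.card_line l hl, ← Finset.card_union_of_disjoint]
  · congr 1
    ext x
    simp only [Finset.mem_union, Finset.mem_biUnion, Finset.mem_sdiff, Finset.mem_inter, mem_perp]
    constructor
    · intro hx
      by_cases hxl : x ∈ l
      · exact Or.inl hxl
      · obtain ⟨r, hr, hxr⟩ := G.exists_proj l hl x
        exact Or.inr ⟨r, hr, ⟨hx, hxr.symm⟩, hxl⟩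
    · rintro (hx | ⟨p, _, ⟨hx, _⟩, _⟩)
      · exact hlZ hx
      · exact hx
  · rw [Finset.disjoint_left]
    intro x hx
    simp [hx]
  · intro p hp r hr hpr
    rw [Function.onFun, Finset.disjoint_left]
    intro x hx hx'
    simp only [Finset.mem_sdiff, Finset.mem_inter, mem_perp] at hx hx'
    exact hpr (G.proj_unique l hl x hx.2 p hp r hr hx.1.2.symm hx'.1.2.symm)

/-- If `p` lies on no line contained in `Z` other than `l`, and lines not contained in `Z` meet
it in at most two points, then at most `t` points of `Z` off `l` are collinear with `p`. -/
lemma card_sdiff_le {l : Finset P} (hl : l ∈ G.lines) (hlZ : l ⊆ Z) {p : P} (hp : p ∈ l)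
    (htwo : ∀ m ∈ G.lines, m ⊆ Z ∨ #(Z ∩ m) ≤ 2)
    (h : ∀ k ∈ G.lines, k ⊆ Z → p ∈ k → k = l) : #((Z ∩ G.perp p) \ l) ≤ t := by
  have hlp : l ∈ G.pencil p := G.mem_pencil.2 ⟨hl, hp⟩
  have hsub : (Z ∩ G.perp p) \ l ⊆ ((G.pencil p).erase l).biUnion fun m => (Z ∩ m).erase p := by
    intro x hx
    simp only [Finset.mem_sdiff, Finset.mem_inter, mem_perp] at hx
    obtain ⟨⟨hxZ, m, hm, hpm, hxm⟩, hxl⟩ := hx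
    simp only [Finset.mem_biUnion, Finset.mem_erase, Finset.mem_inter, mem_pencil]
    refine ⟨m, ⟨?_, hm, hpm⟩, ?_, hxZ, hxm⟩
    · rintro rfl
      exact hxl hxm
    · rintro rfl
      exact hxl hp
  refine (Finset.card_le_card hsub).trans (Finset.card_biUnion_le.trans ?_)
  have h1 := Finset.sum_le_card_nsmul ((G.pencil p).erase l) (fun m => #((Z ∩ m).erase p)) 1 ?_
  · have h2 : #(G.pencil p) = t + 1 := G.card_pencil p
    rw [Finset.card_erase_of_mem hlp, h2] at h1
    simpa using h1
  · intro m hm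
    rw [Finset.mem_erase, mem_pencil] at hm
    rw [Finset.card_erase_of_mem (by simp [hm.2.2, hlZ hp])]
    rcases htwo m hm.2.1 with h2 | h2
    · exact absurd (h m hm.2.1 h2 hm.2.2) hm.1
    · omega

variable (htwo : ∀ m ∈ G.lines, m ⊆ Z ∨ #(Z ∩ m) ≤ 2)
  (hpair : ∀ l ∈ G.lines, ∀ k ∈ G.lines, l ≠ k → l ⊆ Z → k ⊆ Z → ∀ p ∈ l, p ∈ k →
    Z ∩ G.perp p ⊆ l ∪ k)

include hpair in
lemma card_sdiff_eq {l k : Finset P} (hl : l ∈ G.lines) (hk : k ∈ G.lines) (hlk : l ≠ k)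
    (hlZ : l ⊆ Z) (hkZ : k ⊆ Z) {p : P} (hp : p ∈ l) (hpk : p ∈ k) :
    #((Z ∩ G.perp p) \ l) = t ^ 2 := by
  have h : (Z ∩ G.perp p) \ l = k.erase p := by
    ext x
    simp only [Finset.mem_sdiff, Finset.mem_erase]
    constructor
    · rintro ⟨hx, hxl⟩
      refine ⟨fun h => hxl (h ▸ hp), ?_⟩
      have := hpair l hl k hk hlk hlZ hkZ p hp hpk hx
      rw [Finset.mem_union] at this
      tauto
    · rintro ⟨hne, hx⟩
      refine ⟨Finset.mem_inter.2 ⟨hkZ hx, G.mem_perp.2 ⟨k, hk, hpk, hx⟩⟩, fun hxl => ?_⟩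
      exact hlk (G.eq_of_mem l hl k hk x p hne hxl hp hx hpk)
  rw [h, Finset.card_erase_of_mem hpk, G.card_line k hk]
  rfl

include htwo hpair in
/-- If `Z` is large, then every line in `Z` meets many others in `Z`. -/
lemma lt_card_meeting (ht : 1 < t) (hZ : #Z + t = 2 * t ^ 3 + 2 * t ^ 2 + 1) {l : Finset P}
    (hl : l ∈ G.lines) (hlZ : l ⊆ Z) :
    t + 1 < #{p ∈ l | ∃ k ∈ G.lines, k ≠ l ∧ k ⊆ Z ∧ p ∈ k} := by
  set A := {p ∈ l | ∃ k ∈ G.lines, k ≠ l ∧ k ⊆ Z ∧ p ∈ k} with hA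
  by_contra! hle
  have h1 := G.card_eq_sum_sdiff hl hlZ
  have h2 := Finset.sum_filter_add_sum_filter_not l
    (fun p => ∃ k ∈ G.lines, k ≠ l ∧ k ⊆ Z ∧ p ∈ k) (fun p => #((Z ∩ G.perp p) \ l))
  have h3 : ∑ p ∈ A, #((Z ∩ G.perp p) \ l) = #A * t ^ 2 := by
    refine Finset.sum_const_nat fun p hp => ?_
    rw [hA, Finset.mem_filter] at hp
    obtain ⟨hp, k, hk, hkl, hkZ, hpk⟩ := hp
    exact G.card_sdiff_eq hpair hl hk hkl.symm hlZ hkZ hp hpk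
  have h4 := Finset.sum_le_card_nsmul
    {p ∈ l | ¬ ∃ k ∈ G.lines, k ≠ l ∧ k ⊆ Z ∧ p ∈ k} (fun p => #((Z ∩ G.perp p) \ l)) t ?_
  · have h5 := Finset.card_filter_add_card_filter_not (s := l)
      (fun p => ∃ k ∈ G.lines, k ≠ l ∧ k ⊆ Z ∧ p ∈ k)
    rw [← hA, G.card_line l hl] at h5
    rw [← hA, h3] at h2
    rw [smul_eq_mul] at h4
    generalize #{p ∈ l | ¬ ∃ k ∈ G.lines, k ≠ l ∧ k ⊆ Z ∧ p ∈ k} = b at *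
    generalize #A = a at *
    zify at *
    have hb : (b : ℤ) = t ^ 2 + 1 - a := by linarith
    rw [hb] at h4
    nlinarith [mul_nonneg (sub_nonneg.2 hle)
      (mul_nonneg (by positivity : (0 : ℤ) ≤ t) (by linarith : (0 : ℤ) ≤ (t : ℤ) - 1)),
      mul_pos (by linarith : (0 : ℤ) < t) (by linarith : (0 : ℤ) < (t : ℤ) - 1)]
  · intro p hp
    rw [Finset.mem_filter] at hp
    refine G.card_sdiff_le hl hlZ hp.1 htwo fun k hk hkZ hpk => ?_
    by_contra hne
    exact hp.2 ⟨k, hk, hne, hkZ, hpk⟩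

include htwo hpair in
/-- If `Z` is large, then every point of a line in `Z` lies on a second line in `Z`. -/
lemma exists_second_line (ht : 1 < t) (hZ : #Z + t = 2 * t ^ 3 + 2 * t ^ 2 + 1) {l : Finset P}
    (hl : l ∈ G.lines) (hlZ : l ⊆ Z) {p : P} (hp : p ∈ l) :
    ∃ k ∈ G.lines, k ≠ l ∧ k ⊆ Z ∧ p ∈ k := by
  by_contra hcon
  have h1 := G.lt_card_meeting htwo hpair ht hZ hl hlZ
  obtain ⟨p₁, hp₁⟩ := Finset.card_pos.1 ((Nat.succ_pos t).trans h1)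
  rw [Finset.mem_filter] at hp₁
  obtain ⟨hp₁l, k, hk, hkl, hkZ, hp₁k⟩ := hp₁
  have hpp₁ : p ≠ p₁ := by
    rintro rfl
    exact hcon ⟨k, hk, hkl, hkZ, hp₁k⟩
  have h2 := G.lt_card_meeting htwo hpair ht hZ hk hkZ
  set Y := ({p ∈ k | ∃ n ∈ G.lines, n ≠ k ∧ n ⊆ Z ∧ p ∈ n}).erase p₁ with hY
  have hYcard : t < #Y := by
    have := Finset.pred_card_le_card_erase
      (s := {p ∈ k | ∃ n ∈ G.lines, n ≠ k ∧ n ⊆ Z ∧ p ∈ n}) (a := p₁)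
    rw [← hY] at this
    omega
  have hpk : p ∉ k := fun h => hkl (G.eq_of_mem k hk l hl p p₁ hpp₁ h hp₁k hp hp₁l)
  have hex : ∀ y ∈ Y, ∃ z ∈ (Z ∩ G.perp p) \ l, Coll G.lines z y := by
    intro y hy
    rw [hY, Finset.mem_erase, Finset.mem_filter] at hy
    obtain ⟨hyp, hyk, n, hn, hnk, hnZ, hyn⟩ := hy
    obtain ⟨z, hz, hpz⟩ := G.exists_proj n hn p
    refine ⟨z, ?_, n, hn, hz, hyn⟩
    rw [Finset.mem_sdiff, Finset.mem_inter, mem_perp]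
    refine ⟨⟨hnZ hz, hpz⟩, fun hzl => ?_⟩
    have hzp : p₁ ≠ z := by
      rintro rfl
      exact hnk (G.eq_of_mem n hn k hk y p₁ hyp hyn hz hyk hp₁k)
    have hyl : y ∈ l := G.mem_of_coll hl hp₁l hzl hzp ⟨k, hk, hyk, hp₁k⟩ ⟨n, hn, hyn, hz⟩
    exact hkl (G.eq_of_mem k hk l hl y p₁ hyp hyk hp₁k hyl hp₁l)
  choose! z hz hzy using hex
  have hinj : Set.InjOn z Y := by
    intro y hy y' hy' hyy'
    have hyY := hy
    have hyY' := hy'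
    rw [Finset.mem_coe, hY, Finset.mem_erase, Finset.mem_filter] at hy hy'
    by_contra hne
    have h3 := hz y hyY
    rw [Finset.mem_sdiff, Finset.mem_inter, mem_perp] at h3
    have hzk : z y ∈ k := G.mem_of_coll hk hy.2.1 hy'.2.1 hne (hzy y hyY)
      (hyy' ▸ hzy y' hyY')
    refine h3.2 ?_
    rw [G.proj_unique k hk p hpk (z y) hzk p₁ hp₁k h3.1.2 ⟨l, hl, hp, hp₁l⟩]
    exact hp₁l
  have h3 := Finset.card_le_card_of_injOn z hz hinj
  have h4 := G.card_sdiff_le hl hlZ hp htwo fun n hn hnZ hpn => by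
    by_contra hne
    exact hcon ⟨n, hn, hne, hnZ, hpn⟩
  omega

include htwo hpair in
/-- A point set behaving like a quadric without planes does not have
`2t³ + 2t² - t + 1` points. -/
theorem card_ne (ht : 1 < t) : #Z + t ≠ 2 * t ^ 3 + 2 * t ^ 2 + 1 := by
  intro hZ
  by_cases hex : ∃ l ∈ G.lines, l ⊆ Z
  · obtain ⟨l, hl, hlZ⟩ := hex
    have h1 := G.card_eq_sum_sdiff hl hlZ
    rw [Finset.sum_const_nat (m := t ^ 2), G.card_line l hl] at h1
    · rw [h1] at hZ
      obtain ⟨s, rfl⟩ : ∃ s, t = s + 2 := ⟨t - 2, by omega⟩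
      ring_nf at hZ
      have h0 : s ^ 4 + 6 * s ^ 3 + 12 * s ^ 2 + 9 * s + 2 = 0 := by nlinarith
      omega
    · intro p hp
      obtain ⟨k, hk, hkl, hkZ, hpk⟩ := G.exists_second_line htwo hpair ht hZ hl hlZ hp
      exact G.card_sdiff_eq hpair hl hk hkl.symm hlZ hkZ hp hpk
  · have h1 := G.card_le_of_card_inter_le Z 2 fun m hm =>
      (htwo m hm).resolve_left fun h => hex ⟨m, hm, h⟩
    nlinarith

end Intersection

end GenQuad

end GeneralizedQuadrangle

section FiniteField

open scoped Classical Finset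

/-- If a map into a set of size at most `a` has fibres of size at most `b`, and its domain has
`a * b` elements, then all fibres have size exactly `b`. -/
lemma card_fiber_eq_of_card_eq_mul {α β : Type*} {f : α → β} {A : Finset α} {S : Finset β}
    {a b : ℕ} (hmaps : ∀ x ∈ A, f x ∈ S) (hS : #S ≤ a) (hA : #A = a * b)
    (hfib : ∀ c ∈ S, #{x ∈ A | f x = c} ≤ b) {c : β} (hc : c ∈ S) :
    #{x ∈ A | f x = c} = b := by
  have h1 := Finset.card_eq_sum_card_fiberwise (s := A) (t := S) (f := f) hmaps
  have h2 : ∑ c ∈ S, #{x ∈ A | f x = c} = ∑ _c ∈ S, b := by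
    apply le_antisymm (Finset.sum_le_sum hfib)
    rw [← h1, hA, Finset.sum_const, smul_eq_mul]
    exact Nat.mul_le_mul_right b hS
  exact (Finset.sum_eq_sum_iff_of_le hfib).1 h2 c hc

lemma card_filter_eval_eq_zero_le {F : Type*} [Field F] [Fintype F] {f : Polynomial F}
    (hf : f ≠ 0) : #{x | f.eval x = 0} ≤ f.natDegree := by
  refine le_trans (Finset.card_le_card ?_) ((Multiset.toFinset_card_le _).trans f.card_roots')
  intro x hx
  simpa [hf] using hx

variable {t : ℕ} {F : Type*} [Field F] [Fintype F] (hF : Fintype.card F = t ^ 2)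

include hF in
lemma add_pow_of_card_eq_sq (ht : IsPrimePow t) (a b : F) : (a + b) ^ t = a ^ t + b ^ t := by
  obtain ⟨p, k, hp, hk, rfl⟩ := (isPrimePow_nat_iff t).1 ht
  obtain ⟨r, _⟩ := CharP.exists F
  obtain ⟨n, hr, hn⟩ := FiniteField.card F r
  have hrp : r = p := by
    have h1 : r ∣ Fintype.card F := hn ▸ dvd_pow_self r n.ne_zero
    rw [hF] at h1
    exact (Nat.prime_dvd_prime_iff_eq hr hp).1
      (hr.dvd_of_dvd_pow (hr.dvd_of_dvd_pow h1))
  subst hrp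
  have := Fact.mk hp
  exact add_pow_char_pow a b r k

include hF in
lemma pow_pow_of_card_eq_sq (a : F) : (a ^ t) ^ t = a := by
  rw [← pow_mul, ← sq, ← hF, FiniteField.pow_card]

lemma card_filter_pow_eq_self_le (ht1 : 1 < t) : #{c : F | c ^ t = c} ≤ t := by
  have hd : (Polynomial.X ^ t - Polynomial.X : Polynomial F).natDegree = t := by
    compute_degree!
    · simp [ht1.ne]
    · exact ht1.le
  have h := card_filter_eval_eq_zero_le (f := (Polynomial.X ^ t - Polynomial.X : Polynomial F))
    (fun h0 => by rw [h0, Polynomial.natDegree_zero] at hd; omega)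
  rw [hd] at h
  simpa [sub_eq_zero] using h

include hF in
/-- The fibres of the trace of `F` over its subfield of order `t`. -/
lemma card_trace_fiber (ht : IsPrimePow t) {c : F} (hc : c ^ t = c) :
    #{x : F | x ^ t + x = c} = t := by
  have ht1 := ht.one_lt
  refine card_fiber_eq_of_card_eq_mul (f := fun x : F => x ^ t + x)
    (A := Finset.univ) (S := {c : F | c ^ t = c}) (a := t) ?_ (card_filter_pow_eq_self_le ht1) ?_ ?_
    (by simpa using hc)
  · intro x _
    simp only [Finset.mem_filter, Finset.mem_univ, true_and]
    rw [add_pow_of_card_eq_sq hF ht, pow_pow_of_card_eq_sq hF, add_comm]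
  · rw [Finset.card_univ, hF, sq]
  · intro c _
    have hd : (Polynomial.X ^ t + Polynomial.X - Polynomial.C c : Polynomial F).natDegree = t := by
      compute_degree!
      · simp [ht1.ne, (zero_lt_one.trans ht1).ne']
      · omega
    have h := card_filter_eval_eq_zero_le
      (f := (Polynomial.X ^ t + Polynomial.X - Polynomial.C c : Polynomial F))
      (fun h0 => by rw [h0, Polynomial.natDegree_zero] at hd; omega)
    rw [hd] at h
    simpa [sub_eq_zero] using h

include hF in
/-- The fibres of the norm of `F` over its subfield of order `t`. -/
lemma card_norm_fiber (ht : IsPrimePow t) {c : F} (hc : c ^ t = c) (hc0 : c ≠ 0) :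
    #{x : F | x ^ (t + 1) = c} = t + 1 := by
  have ht1 := ht.one_lt
  have h := card_fiber_eq_of_card_eq_mul (f := fun x : F => x ^ (t + 1))
    (A := Finset.univ.erase 0) (S := ({c : F | c ^ t = c} : Finset F).erase 0) (a := t - 1)
    (b := t + 1) (c := c) ?_ ?_ ?_ ?_ (by simp [hc, hc0])
  · refine Eq.trans ?_ h
    congr 1
    ext x
    simp only [Finset.mem_filter, Finset.mem_univ, true_and, Finset.mem_erase, and_true]
    refine ⟨fun hx => ⟨?_, hx⟩, fun hx => hx.2⟩
    rintro rfl
    rw [zero_pow (Nat.succ_ne_zero t)] at hx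
    exact hc0 hx.symm
  · intro x hx
    rw [Finset.mem_erase] at hx
    rw [Finset.mem_erase, Finset.mem_filter]
    refine ⟨pow_ne_zero _ hx.1, Finset.mem_univ _, ?_⟩
    rw [pow_succ, mul_pow, pow_pow_of_card_eq_sq hF, mul_comm]
  · rw [Finset.card_erase_of_mem (by simp [(zero_lt_one.trans ht1).ne'])]
    exact Nat.sub_le_sub_right (card_filter_pow_eq_self_le ht1) 1
  · rw [Finset.card_erase_of_mem (Finset.mem_univ _), Finset.card_univ, hF, mul_comm,
      ← Nat.sq_sub_sq, one_pow]
  · intro c _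
    have hd : (Polynomial.X ^ (t + 1) - Polynomial.C c : Polynomial F).natDegree = t + 1 := by
      compute_degree!
    have h := card_filter_eval_eq_zero_le
      (f := (Polynomial.X ^ (t + 1) - Polynomial.C c : Polynomial F))
      (fun h0 => by rw [h0, Polynomial.natDegree_zero] at hd; omega)
    rw [hd] at h
    refine (Finset.card_le_card ?_).trans h
    intro x hx
    simpa [sub_eq_zero] using (Finset.mem_filter.1 hx).2

include hF in
lemma norm_sum_pow (ht : IsPrimePow t) {n : ℕ} (x : Fin n → F) :
    (∑ i, x i ^ (t + 1)) ^ t = ∑ i, x i ^ (t + 1) := by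
  have h : ∀ s : Finset (Fin n), (∑ i ∈ s, x i ^ (t + 1)) ^ t = ∑ i ∈ s, x i ^ (t + 1) := by
    intro s
    induction s using Finset.induction_on with
    | empty => simp [(zero_lt_one.trans ht.one_lt).ne']
    | insert i s hi ih =>
      rw [Finset.sum_insert hi, add_pow_of_card_eq_sq hF ht, ih]
      congr 1
      rw [pow_succ, mul_pow, pow_pow_of_card_eq_sq hF, mul_comm]
  exact h _

include hF in
/-- The recursion for the number of isotropic vectors of the standard Hermitian form. -/
lemma card_isotropic_succ (ht : IsPrimePow t) (n : ℕ) :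
    #{x : Fin (n + 1) → F | ∑ i, x i ^ (t + 1) = 0} + t * #{x : Fin n → F | ∑ i, x i ^ (t + 1) = 0}
      = (t + 1) * t ^ (2 * n) := by
  have h1 : #{x : Fin (n + 1) → F | ∑ i, x i ^ (t + 1) = 0} =
      ∑ y : Fin n → F, #{a : F | a ^ (t + 1) = -∑ i, y i ^ (t + 1)} := by
    rw [Finset.card_eq_sum_card_fiberwise (f := fun x : Fin (n + 1) → F => Fin.tail x)
      (t := Finset.univ) (by intro x _; simp)]
    refine Finset.sum_congr rfl fun y _ => ?_
    symm
    refine Finset.card_bij (fun a _ => Fin.cons a y) ?_ ?_ ?_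
    · intro a ha
      simp only [Finset.mem_filter, Finset.mem_univ, true_and] at ha ⊢
      simp [Fin.sum_univ_succ, ha]
    · intro a _ b _ hab
      simpa using congrFun hab 0
    · intro x hx
      simp only [Finset.mem_filter, Finset.mem_univ, true_and] at hx
      refine ⟨x 0, ?_, ?_⟩
      · simp only [Finset.mem_filter, Finset.mem_univ, true_and]
        rw [← hx.2, eq_neg_iff_add_eq_zero, ← hx.1, Fin.sum_univ_succ]
        rfl
      · rw [← hx.2, Fin.cons_self_tail]
  have h2 : ∀ y : Fin n → F, #{a : F | a ^ (t + 1) = -∑ i, y i ^ (t + 1)} +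
      (if ∑ i, y i ^ (t + 1) = 0 then t else 0) = t + 1 := by
    intro y
    split_ifs with h
    · rw [h, add_comm]
      congr 1
      rw [Finset.card_eq_one]
      refine ⟨0, ?_⟩
      ext a
      simp
    · rw [add_zero]
      refine card_norm_fiber hF ht ?_ (neg_ne_zero.2 h)
      have h3 := add_pow_of_card_eq_sq hF ht (∑ i, y i ^ (t + 1)) (-∑ i, y i ^ (t + 1))
      rw [add_neg_cancel, zero_pow (zero_lt_one.trans ht.one_lt).ne', norm_sum_pow hF ht] at h3
      exact (neg_eq_of_add_eq_zero_right h3.symm).symm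
  have h3 := Finset.sum_congr (rfl : (Finset.univ : Finset (Fin n → F)) = Finset.univ)
    fun y _ => h2 y
  rw [Finset.sum_add_distrib, ← h1, ← Finset.sum_filter, Finset.sum_const, Finset.sum_const,
    smul_eq_mul, smul_eq_mul, Finset.card_univ, Fintype.card_fun, hF, Fintype.card_fin] at h3
  rw [mul_comm t, h3, ← pow_mul, mul_comm]

include hF in
lemma card_isotropic (ht : IsPrimePow t) :
    #{x : Fin 4 → F | ∑ i, x i ^ (t + 1) = 0} + t ^ 3 = t ^ 7 + t ^ 4 := by
  have h0 : #{x : Fin 0 → F | ∑ i, x i ^ (t + 1) = 0} = 1 := by simp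
  have h1 := card_isotropic_succ hF ht 0
  have h2 := card_isotropic_succ hF ht 1
  have h3 := card_isotropic_succ hF ht 2
  have h4 := card_isotropic_succ hF ht 3
  simp only [Nat.reduceAdd] at h1 h2 h3 h4
  rw [h0] at h1
  zify at *
  generalize (#{x : Fin 1 → F | ∑ i, x i ^ (t + 1) = 0} : ℤ) = n₁ at *
  generalize (#{x : Fin 2 → F | ∑ i, x i ^ (t + 1) = 0} : ℤ) = n₂ at *
  generalize (#{x : Fin 3 → F | ∑ i, x i ^ (t + 1) = 0} : ℤ) = n₃ at *
  linear_combination h4 - t * h3 + t ^ 2 * h2 - t ^ 3 * h1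

end FiniteField

section HermitianForm

open scoped Classical Finset

/-- The standard Hermitian form on `F⁴`. -/
def herm (t : ℕ) {F : Type*} [Field F] (x y : Fin 4 → F) : F := ∑ i, x i * y i ^ t

variable {t : ℕ} {F : Type*} [Field F]

lemma herm_add_left (x y z : Fin 4 → F) : herm t (x + y) z = herm t x z + herm t y z := by
  simp [herm, add_mul, Finset.sum_add_distrib]

lemma herm_smul_left (a : F) (x z : Fin 4 → F) : herm t (a • x) z = a * herm t x z := by
  simp [herm, mul_assoc, Finset.mul_sum]

lemma herm_smul_right (a : F) (x z : Fin 4 → F) : herm t x (a • z) = a ^ t * herm t x z := by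
  simp only [herm, Finset.mul_sum, Pi.smul_apply, smul_eq_mul]
  exact Finset.sum_congr rfl fun i _ => by ring

lemma herm_lincomb_left (x y z : Fin 4 → F) (a b : F) (hy : herm t y x = 0)
    (hz : herm t z x = 0) : herm t (a • y + b • z) x = 0 := by
  rw [herm_add_left, herm_smul_left, herm_smul_left, hy, hz, mul_zero, mul_zero, add_zero]

lemma herm_self (x : Fin 4 → F) : herm t x x = ∑ i, x i ^ (t + 1) :=
  Finset.sum_congr rfl fun i _ => by ring

/-- The Hermitian form as a linear functional in its first argument. -/
def hermDual (t : ℕ) {F : Type*} [Field F] (y : Fin 4 → F) : Module.Dual F (Fin 4 → F) where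
  toFun x := herm t x y
  map_add' x z := herm_add_left x z y
  map_smul' a x := herm_smul_left a x y

@[simp]
lemma hermDual_apply (x y : Fin 4 → F) : hermDual t y x = herm t x y := rfl

lemma eq_zero_of_herm_eq_zero {y : Fin 4 → F} (h : ∀ x, herm t x y = 0) : y = 0 := by
  funext i
  have := h (Pi.single i 1)
  simp only [herm, Pi.single_apply, ite_mul, one_mul, zero_mul, Finset.sum_ite_eq',
    Finset.mem_univ, if_true] at this
  exact eq_zero_of_pow_eq_zero this

variable [Fintype F] (hF : Fintype.card F = t ^ 2) (ht : IsPrimePow t)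

include hF ht

lemma herm_add_right (x y z : Fin 4 → F) : herm t x (y + z) = herm t x y + herm t x z := by
  simp [herm, add_pow_of_card_eq_sq hF ht, mul_add, Finset.sum_add_distrib]

lemma herm_swap (x y : Fin 4 → F) : herm t y x = herm t x y ^ t := by
  let σ : F →+ F :=
    { toFun := fun a => a ^ t
      map_zero' := zero_pow (zero_lt_one.trans ht.one_lt).ne'
      map_add' := add_pow_of_card_eq_sq hF ht }
  change _ = σ (herm t x y)
  rw [herm, herm, map_sum]
  refine Finset.sum_congr rfl fun i _ => ?_
  change _ = (x i * y i ^ t) ^ t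
  rw [mul_pow, pow_pow_of_card_eq_sq hF, mul_comm]

lemma herm_eq_zero_comm {x y : Fin 4 → F} : herm t x y = 0 ↔ herm t y x = 0 := by
  rw [herm_swap hF ht x y, pow_eq_zero_iff (zero_lt_one.trans ht.one_lt).ne']

lemma herm_lincomb_right (x y z : Fin 4 → F) (a b : F) (hy : herm t x y = 0)
    (hz : herm t x z = 0) : herm t x (a • y + b • z) = 0 := by
  rw [herm_add_right hF ht, herm_smul_right, herm_smul_right, hy, hz, mul_zero, mul_zero, add_zero]

/-- A totally isotropic plane is its own orthogonal complement. -/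
lemma exists_lincomb_of_herm_eq_zero {p r x : Fin 4 → F} (hli : LinearIndependent F ![p, r])
    (hpp : herm t p p = 0) (hrr : herm t r r = 0) (hpr : herm t p r = 0)
    (hxp : herm t x p = 0) (hxr : herm t x r = 0) : ∃ a b : F, x = a • p + b • r := by
  have ht0 : t ≠ 0 := (zero_lt_one.trans ht.one_lt).ne'
  have hli' : LinearIndependent F ![hermDual t p, hermDual t r] := by
    rw [LinearIndependent.pair_iff] at hli ⊢
    intro a b hab
    have h := hli (a ^ t) (b ^ t) (eq_zero_of_herm_eq_zero (t := t) fun x => ?_)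
    · simpa [ht0] using h
    · rw [herm_add_right hF ht, herm_smul_right, herm_smul_right, pow_pow_of_card_eq_sq hF,
        pow_pow_of_card_eq_sq hF]
      simpa using LinearMap.congr_fun hab x
  have h1 := finrank_span_eq_card hli
  have h2 := finrank_span_eq_card hli'
  have h3 := Subspace.finrank_add_finrank_dualCoannihilator_eq
    (Submodule.span F (Set.range ![hermDual t p, hermDual t r]))
  rw [h2, Module.finrank_fin_fun, Fintype.card_fin] at h3
  have hmem : ∀ y, herm t y p = 0 → herm t y r = 0 → y ∈
      (Submodule.span F (Set.range ![hermDual t p, hermDual t r])).dualCoannihilator := by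
    intro y hyp hyr
    rw [Submodule.mem_dualCoannihilator]
    intro φ hφ
    induction hφ using Submodule.span_induction with
    | mem φ hφ =>
      obtain ⟨i, rfl⟩ := hφ
      fin_cases i
      · exact hyp
      · exact hyr
    | zero => rfl
    | add φ ψ _ _ h h' => rw [LinearMap.add_apply, h, h', add_zero]
    | smul a φ _ h => rw [LinearMap.smul_apply, h, smul_zero]
  have hle : Submodule.span F (Set.range ![p, r]) ≤
      (Submodule.span F (Set.range ![hermDual t p, hermDual t r])).dualCoannihilator := by
    rw [Submodule.span_le]
    rintro _ ⟨i, rfl⟩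
    fin_cases i
    · exact hmem p hpp hpr
    · exact hmem r ((herm_eq_zero_comm hF ht).1 hpr) hrr
  have heq := Submodule.eq_of_le_of_finrank_le hle (by rw [h1, Fintype.card_fin]; omega)
  have hx := hmem x hxp hxr
  rw [← heq, Matrix.range_cons_cons_empty, Submodule.mem_span_pair] at hx
  obtain ⟨a, b, h⟩ := hx
  exact ⟨a, b, h.symm⟩

/-- The number of isotropic vectors not orthogonal to a given nonzero isotropic vector. -/
lemma card_isotropic_not_orthogonal {p : Fin 4 → F} (hp : p ≠ 0) (hpp : herm t p p = 0) :
    #{w : Fin 4 → F | herm t w p ≠ 0 ∧ herm t w w = 0} + t ^ 5 = t ^ 7 := by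
  set A : Finset (Fin 4 → F) := {w | herm t w p ≠ 0} with hA
  have hAcard : #A + t ^ 6 = t ^ 8 := by
    have hne : hermDual t p ≠ 0 := fun h =>
      hp (eq_zero_of_herm_eq_zero fun x => LinearMap.congr_fun h x)
    have h1 := Module.Dual.finrank_ker_add_one_of_ne_zero hne
    rw [Module.finrank_fin_fun] at h1
    have h2 := Module.card_eq_pow_finrank (K := F) (V := LinearMap.ker (hermDual t p))
    have h3 : Module.finrank F (LinearMap.ker (hermDual t p)) = 3 := by omega
    rw [h3, hF, ← pow_mul] at h2
    have h4 := Finset.card_filter_add_card_filter_not (s := Finset.univ)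
      (fun w : Fin 4 → F => herm t w p ≠ 0)
    have h5 : #{w : Fin 4 → F | ¬ herm t w p ≠ 0} = t ^ 6 := by
      rw [← h2, Fintype.card_subtype]
      congr 1
      ext w
      simp
    rw [h5, Finset.card_univ, Fintype.card_fun, hF, ← pow_mul, Fintype.card_fin] at h4
    exact h4
  have hfib : ∀ w ∈ A, #{a : F | herm t (w + a • p) (w + a • p) = 0} = t := by
    intro w hw
    have hc : herm t p w ≠ 0 := fun h =>
      (Finset.mem_filter.1 hw).2 ((herm_eq_zero_comm hF ht).1 h)
    have hww : (-herm t w w) ^ t = -herm t w w := by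
      have h3 := add_pow_of_card_eq_sq hF ht (herm t w w) (-herm t w w)
      rw [add_neg_cancel, zero_pow (zero_lt_one.trans ht.one_lt).ne',
        ← herm_swap hF ht w w] at h3
      exact (neg_eq_of_add_eq_zero_right h3.symm).symm
    refine Eq.trans ?_ (card_trace_fiber hF ht hww)
    refine Finset.card_bij (fun a _ => a * herm t p w) ?_ ?_ ?_
    · intro a ha
      simp only [Finset.mem_filter, Finset.mem_univ, true_and] at ha ⊢
      rw [herm_add_right hF ht, herm_add_left, herm_add_left, herm_smul_left, herm_smul_right,
        herm_smul_right, herm_smul_left, hpp, herm_swap hF ht p w, ← mul_pow] at ha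
      linear_combination ha
    · intro a _ b _ hab
      exact mul_right_cancel₀ hc hab
    · intro b hb
      refine ⟨b / herm t p w, ?_, div_mul_cancel₀ b hc⟩
      simp only [Finset.mem_filter, Finset.mem_univ, true_and] at hb ⊢
      rw [herm_add_right hF ht, herm_add_left, herm_add_left, herm_smul_left, herm_smul_right,
        herm_smul_right, herm_smul_left, hpp, herm_swap hF ht p w, ← mul_pow, div_mul_cancel₀ b hc]
      linear_combination hb
  have hdouble := Finset.sum_card_bipartiteAbove_eq_sum_card_bipartiteBelow
    (s := A) (t := (Finset.univ : Finset F))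
    (fun w a => herm t (w + a • p) (w + a • p) = 0)
  have hleft : ∑ w ∈ A, #(Finset.bipartiteAbove
      (fun w (a : F) => herm t (w + a • p) (w + a • p) = 0) Finset.univ w) = #A * t :=
    Finset.sum_const_nat hfib
  have hright : ∑ a : F, #(Finset.bipartiteBelow
      (fun w (a : F) => herm t (w + a • p) (w + a • p) = 0) A a) =
      t ^ 2 * #{w : Fin 4 → F | herm t w p ≠ 0 ∧ herm t w w = 0} := by
    rw [← hF, ← Finset.card_univ]
    refine Finset.sum_const_nat fun a _ => ?_
    have hshift : ∀ w : Fin 4 → F, herm t (w + a • p) p = herm t w p := by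
      intro w
      rw [herm_add_left, herm_smul_left, hpp, mul_zero, add_zero]
    refine Finset.card_bij (fun w _ => w + a • p) ?_ ?_ ?_
    · intro w hw
      simp only [Finset.bipartiteBelow, hA, Finset.mem_filter, Finset.mem_univ, true_and] at hw ⊢
      exact ⟨(hshift w).symm ▸ hw.1, hw.2⟩
    · intro w _ w' _ h
      exact add_right_cancel h
    · intro w hw
      simp only [Finset.mem_filter, Finset.mem_univ, true_and] at hw
      refine ⟨w - a • p, ?_, sub_add_cancel _ _⟩
      simp only [Finset.bipartiteBelow, hA, Finset.mem_filter, Finset.mem_univ, true_and,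
        sub_add_cancel]
      refine ⟨?_, hw.2⟩
      rw [← hshift, sub_add_cancel]
      exact hw.1
  rw [hleft, hright] at hdouble
  have ht0 : 0 < t ^ 2 := pow_pos (zero_lt_one.trans ht.one_lt) 2
  apply Nat.eq_of_mul_eq_mul_left ht0
  rw [mul_add, ← hdouble]
  calc #A * t + t ^ 2 * t ^ 5 = (#A + t ^ 6) * t := by ring
    _ = t ^ 2 * t ^ 7 := by rw [hAcard]; ring

end HermitianForm

section HermitianSurface

open scoped Classical Finset

variable {t : ℕ} {F : Type} [Field F]

/-- The chosen representative of a point of the Hermitian surface. -/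
noncomputable def vec (x : ↥(hermSurf t F)) : Fin 4 → F := (x : ℙ F (Fin 4 → F)).rep

lemma vec_ne_zero (x : ↥(hermSurf t F)) : vec x ≠ 0 := Projectivization.rep_nonzero _

lemma herm_vec_self (x : ↥(hermSurf t F)) : herm t (vec x) (vec x) = 0 := by
  rw [herm_self]
  exact x.2

lemma eq_of_vec_eq_smul {x y : ↥(hermSurf t F)} {a : F} (h : vec x = a • vec y) : x = y := by
  apply Subtype.ext
  rw [← Projectivization.mk_rep x.1, ← Projectivization.mk_rep y.1,
    Projectivization.mk_eq_mk_iff']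
  exact ⟨a, h.symm⟩

lemma exists_eq_smul_vec {v : Fin 4 → F} (hv : v ≠ 0) (hvv : herm t v v = 0) :
    ∃ x : ↥(hermSurf t F), ∃ a : F, a ≠ 0 ∧ v = a • vec x := by
  obtain ⟨a, ha⟩ := Projectivization.exists_smul_eq_mk_rep F v hv
  have h : Projectivization.mk F v hv ∈ hermSurf t F := by
    change ∑ i, _ = (0 : F)
    rw [← herm_self, ← ha, Units.smul_def, herm_smul_left, herm_smul_right, hvv, mul_zero,
      mul_zero]
  refine ⟨⟨_, h⟩, (a⁻¹ : Fˣ), Units.ne_zero _, ?_⟩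
  rw [vec, ← ha, ← Units.smul_def, inv_smul_smul]

lemma vec_lincomb_eq_zero {p r : ↥(hermSurf t F)} (h : p ≠ r) {a b : F}
    (hab : a • vec p + b • vec r = 0) : a = 0 ∧ b = 0 := by
  have ha : a = 0 := by
    by_contra ha
    refine h (eq_of_vec_eq_smul (a := -(a⁻¹ * b)) ?_)
    rw [← inv_smul_smul₀ ha (vec p), eq_neg_of_add_eq_zero_left hab, neg_smul, mul_smul, smul_neg]
  subst ha
  rw [zero_smul, zero_add] at hab
  exact ⟨rfl, (smul_eq_zero.1 hab).resolve_right (vec_ne_zero r)⟩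

lemma linearIndependent_vec {p r : ↥(hermSurf t F)} (h : p ≠ r) :
    LinearIndependent F ![vec p, vec r] :=
  LinearIndependent.pair_iff.2 fun _ _ => vec_lincomb_eq_zero h

variable [Fintype F]

noncomputable instance hermSurfFintype : Fintype ↥(hermSurf t F) := Fintype.ofFinite _

noncomputable instance hermSurfDecidableEq : DecidableEq ↥(hermSurf t F) :=
  fun _ _ => Classical.propDecidable _

/-- Passing between projective and vectorial counts. -/
lemma card_points_mul (R : (Fin 4 → F) → Prop) (hR : ∀ a : F, a ≠ 0 → ∀ v, R (a • v) ↔ R v) :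
    #{x : ↥(hermSurf t F) | R (vec x)} * (Fintype.card F - 1) =
      #{v : Fin 4 → F | v ≠ 0 ∧ herm t v v = 0 ∧ R v} := by
  rw [← Finset.card_univ, ← Finset.card_erase_of_mem (Finset.mem_univ (0 : F)),
    ← Finset.card_product]
  refine Finset.card_bij (fun z _ => z.2 • vec z.1) ?_ ?_ ?_
  · rintro ⟨x, a⟩ hz
    simp only [Finset.mem_product, Finset.mem_filter, Finset.mem_univ, true_and,
      Finset.mem_erase, and_true] at hz ⊢
    refine ⟨smul_ne_zero hz.2 (vec_ne_zero x), ?_, (hR _ hz.2 _).2 hz.1⟩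
    rw [herm_smul_left, herm_smul_right, herm_vec_self, mul_zero, mul_zero]
  · rintro ⟨x, a⟩ hz ⟨y, b⟩ hw h
    simp only [Finset.mem_product, Finset.mem_erase] at hz hw h
    have hxy : x = y := by
      refine eq_of_vec_eq_smul (a := a⁻¹ * b) ?_
      rw [mul_smul, ← h, inv_smul_smul₀ hz.2.1]
    subst hxy
    rw [smul_left_injective F (vec_ne_zero x) h]
  · intro v hv
    simp only [Finset.mem_filter, Finset.mem_univ, true_and] at hv
    obtain ⟨x, a, ha, rfl⟩ := exists_eq_smul_vec hv.1 hv.2.1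
    refine ⟨(x, a), ?_, rfl⟩
    simp only [Finset.mem_product, Finset.mem_filter, Finset.mem_univ, true_and,
      Finset.mem_erase, and_true]
    exact ⟨(hR a ha _).1 hv.2.2, ha⟩

/-- The points of the surface orthogonal to both `p` and `r`. -/
noncomputable def hermLine (p r : ↥(hermSurf t F)) : Finset ↥(hermSurf t F) :=
  {x | herm t (vec x) (vec p) = 0 ∧ herm t (vec x) (vec r) = 0}

lemma mem_hermLine {p r x : ↥(hermSurf t F)} : x ∈ hermLine p r ↔
    herm t (vec x) (vec p) = 0 ∧ herm t (vec x) (vec r) = 0 := by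
  simp [hermLine]

lemma left_mem_hermLine {p r : ↥(hermSurf t F)} (h : herm t (vec p) (vec r) = 0) :
    p ∈ hermLine p r := mem_hermLine.2 ⟨herm_vec_self p, h⟩

/-- The generators of the Hermitian surface. -/
noncomputable def hermGenerators (t : ℕ) (F : Type) [Field F] [Fintype F] :
    Finset (Finset ↥(hermSurf t F)) :=
  {l | ∃ p r, p ≠ r ∧ herm t (vec p) (vec r) = 0 ∧ l = hermLine p r}

lemma mem_hermGenerators {l : Finset ↥(hermSurf t F)} : l ∈ hermGenerators t F ↔
    ∃ p r, p ≠ r ∧ herm t (vec p) (vec r) = 0 ∧ l = hermLine p r := by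
  simp [hermGenerators]

variable (hF : Fintype.card F = t ^ 2) (ht : IsPrimePow t)

include hF ht

lemma mem_hermLine_iff_exists {p r x : ↥(hermSurf t F)} (hne : p ≠ r)
    (h : herm t (vec p) (vec r) = 0) :
    x ∈ hermLine p r ↔ ∃ a b : F, vec x = a • vec p + b • vec r := by
  rw [mem_hermLine]
  constructor
  · rintro ⟨h1, h2⟩
    exact exists_lincomb_of_herm_eq_zero hF ht (linearIndependent_vec hne) (herm_vec_self p)
      (herm_vec_self r) h h1 h2
  · rintro ⟨a, b, hx⟩
    rw [hx]
    exact ⟨herm_lincomb_left _ _ _ _ _ (herm_vec_self p) ((herm_eq_zero_comm hF ht).1 h),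
      herm_lincomb_left _ _ _ _ _ h (herm_vec_self r)⟩

lemma herm_eq_zero_of_mem_hermLine {p r x y : ↥(hermSurf t F)} (hne : p ≠ r)
    (h : herm t (vec p) (vec r) = 0) (hx : x ∈ hermLine p r) (hy : y ∈ hermLine p r) :
    herm t (vec x) (vec y) = 0 := by
  obtain ⟨a, b, hab⟩ := (mem_hermLine_iff_exists hF ht hne h).1 hy
  rw [mem_hermLine] at hx
  rw [hab]
  exact herm_lincomb_right hF ht _ _ _ _ _ hx.1 hx.2

lemma right_mem_hermLine {p r : ↥(hermSurf t F)} (h : herm t (vec p) (vec r) = 0) :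
    r ∈ hermLine p r := mem_hermLine.2 ⟨(herm_eq_zero_comm hF ht).1 h, herm_vec_self r⟩

lemma hermLine_subset {p r x y : ↥(hermSurf t F)} (hne : p ≠ r)
    (h : herm t (vec p) (vec r) = 0) (hx : x ∈ hermLine p r) (hy : y ∈ hermLine p r) :
    hermLine p r ⊆ hermLine x y := fun _ hz => mem_hermLine.2
  ⟨herm_eq_zero_of_mem_hermLine hF ht hne h hz hx, herm_eq_zero_of_mem_hermLine hF ht hne h hz hy⟩

lemma eq_hermLine_of_mem {l : Finset ↥(hermSurf t F)} (hl : l ∈ hermGenerators t F)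
    {x y : ↥(hermSurf t F)} (hx : x ∈ l) (hy : y ∈ l) (hxy : x ≠ y) :
    herm t (vec x) (vec y) = 0 ∧ l = hermLine x y := by
  obtain ⟨p, r, hne, h, rfl⟩ := mem_hermGenerators.1 hl
  have hxy0 := herm_eq_zero_of_mem_hermLine hF ht hne h hx hy
  have hsub := hermLine_subset hF ht hne h hx hy
  exact ⟨hxy0, hsub.antisymm (hermLine_subset hF ht hxy hxy0
    (hsub (left_mem_hermLine h)) (hsub (right_mem_hermLine hF ht h)))⟩

lemma herm_eq_zero_of_coll {p r : ↥(hermSurf t F)} (h : Coll (hermGenerators t F) p r) :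
    herm t (vec p) (vec r) = 0 := by
  obtain ⟨l, hl, hp, hr⟩ := h
  obtain ⟨a, b, hne, hab, rfl⟩ := mem_hermGenerators.1 hl
  exact herm_eq_zero_of_mem_hermLine hF ht hne hab hp hr

lemma coll_of_herm_eq_zero {p r : ↥(hermSurf t F)} (hne : p ≠ r)
    (h : herm t (vec p) (vec r) = 0) : Coll (hermGenerators t F) p r :=
  ⟨hermLine p r, mem_hermGenerators.2 ⟨p, r, hne, h, rfl⟩, left_mem_hermLine h,
    right_mem_hermLine hF ht h⟩

lemma card_hermSurf : Fintype.card ↥(hermSurf t F) = (t ^ 2 + 1) * (t ^ 3 + 1) := by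
  have h : #{x : ↥(hermSurf t F) | True} * (Fintype.card F - 1) =
      #{v : Fin 4 → F | v ≠ 0 ∧ herm t v v = 0 ∧ True} := by
    convert card_points_mul (t := t) (F := F) (fun _ => True) (by simp)
  have h1 := card_isotropic hF ht
  have h2 : #{v : Fin 4 → F | v ≠ 0 ∧ herm t v v = 0 ∧ True} + 1 =
      #{x : Fin 4 → F | ∑ i, x i ^ (t + 1) = 0} := by
    rw [← Finset.card_erase_add_one (s := {x : Fin 4 → F | ∑ i, x i ^ (t + 1) = 0}) (a := 0)
      (by simp)]
    congr 2
    ext v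
    simp [herm_self]
  rw [← h, hF, Finset.filter_true, Finset.card_univ] at h2
  have ht1 := ht.one_lt
  have h3 : 1 ≤ t ^ 2 := Nat.one_le_pow _ _ (by omega)
  have h4 : 0 < t ^ 2 - 1 := Nat.sub_pos_of_lt (Nat.one_lt_pow two_ne_zero ht1)
  apply Nat.eq_of_mul_eq_mul_right h4
  zify [h3] at *
  linear_combination h2 + h1

lemma card_herm_ne_zero (p : ↥(hermSurf t F)) :
    #{x : ↥(hermSurf t F) | herm t (vec x) (vec p) ≠ 0} = t ^ 5 := by
  have h : #{x : ↥(hermSurf t F) | herm t (vec x) (vec p) ≠ 0} * (Fintype.card F - 1) =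
      #{v : Fin 4 → F | v ≠ 0 ∧ herm t v v = 0 ∧ herm t v (vec p) ≠ 0} := by
    convert card_points_mul (t := t) (F := F) (fun v => herm t v (vec p) ≠ 0)
      (by intro a ha v; simp [herm_smul_left, ha])
  have h1 := card_isotropic_not_orthogonal hF ht (vec_ne_zero p) (herm_vec_self p)
  have h2 : #{v : Fin 4 → F | v ≠ 0 ∧ herm t v v = 0 ∧ herm t v (vec p) ≠ 0} =
      #{w : Fin 4 → F | herm t w (vec p) ≠ 0 ∧ herm t w w = 0} := by
    congr 1
    ext v
    simp only [Finset.mem_filter, Finset.mem_univ, true_and]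
    refine ⟨fun h => ⟨h.2.2, h.2.1⟩, fun h => ⟨?_, h.2, h.1⟩⟩
    rintro rfl
    exact h.1 (by simp [herm])
  rw [h2, hF] at h
  rw [← h] at h1
  have ht1 := ht.one_lt
  have h3 : 1 ≤ t ^ 2 := Nat.one_le_pow _ _ (by omega)
  have h4 : 0 < t ^ 2 - 1 := Nat.sub_pos_of_lt (Nat.one_lt_pow two_ne_zero ht1)
  apply Nat.eq_of_mul_eq_mul_right h4
  zify [h3] at *
  linear_combination h1

lemma card_hermLine {p r : ↥(hermSurf t F)} (hne : p ≠ r) (h : herm t (vec p) (vec r) = 0) :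
    #(hermLine p r) = t ^ 2 + 1 := by
  have h1 : #{x : ↥(hermSurf t F) | ∃ a b : F, vec x = a • vec p + b • vec r} *
      (Fintype.card F - 1) =
      #{v : Fin 4 → F | v ≠ 0 ∧ herm t v v = 0 ∧ ∃ a b : F, v = a • vec p + b • vec r} := by
    convert card_points_mul (t := t) (F := F)
      (fun v => ∃ a b : F, v = a • vec p + b • vec r) ?_
    intro c hc v
    constructor
    · rintro ⟨a, b, hab⟩
      refine ⟨c⁻¹ * a, c⁻¹ * b, ?_⟩
      rw [mul_smul, mul_smul, ← smul_add, ← hab, inv_smul_smul₀ hc]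
    · rintro ⟨a, b, rfl⟩
      exact ⟨c * a, c * b, by rw [mul_smul, mul_smul, smul_add]⟩
  have h2 : #{v : Fin 4 → F | v ≠ 0 ∧ herm t v v = 0 ∧ ∃ a b : F, v = a • vec p + b • vec r} =
      #((Finset.univ : Finset (F × F)).erase 0) := by
    symm
    refine Finset.card_bij (fun z _ => z.1 • vec p + z.2 • vec r) ?_ ?_ ?_
    · rintro ⟨a, b⟩ hab
      simp only [Finset.mem_filter, Finset.mem_univ, true_and]
      refine ⟨fun h0 => ?_, ?_, a, b, rfl⟩
      · obtain ⟨ha, hb⟩ := vec_lincomb_eq_zero hne h0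
        simp [ha, hb] at hab
      · have hp := herm_vec_self p
        have hr := herm_vec_self r
        have h' := (herm_eq_zero_comm hF ht).1 h
        exact herm_lincomb_left _ _ _ _ _ (herm_lincomb_right hF ht _ _ _ _ _ hp h)
          (herm_lincomb_right hF ht _ _ _ _ _ h' hr)
    · rintro ⟨a, b⟩ _ ⟨c, d⟩ _ heq
      simp only at heq
      obtain ⟨h1, h2⟩ := vec_lincomb_eq_zero hne (a := a - c) (b := b - d) (by
        rw [sub_smul, sub_smul, ← sub_eq_zero.2 heq]
        abel)
      rw [sub_eq_zero.1 h1, sub_eq_zero.1 h2]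
    · intro v hv
      simp only [Finset.mem_filter, Finset.mem_univ, true_and] at hv
      obtain ⟨hv0, _, a, b, rfl⟩ := hv
      refine ⟨(a, b), ?_, rfl⟩
      rw [Finset.mem_erase]
      refine ⟨fun h0 => hv0 ?_, Finset.mem_univ _⟩
      rw [Prod.mk_eq_zero] at h0
      simp [h0.1, h0.2]
  rw [h2, Finset.card_erase_of_mem (Finset.mem_univ _), Finset.card_univ, Fintype.card_prod,
    hF] at h1
  have h3 : hermLine p r =
      ({x | ∃ a b : F, vec x = a • vec p + b • vec r} : Finset _) := by
    ext x
    rw [mem_hermLine_iff_exists hF ht hne h]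
    simp
  rw [h3]
  have h4 : 0 < t ^ 2 - 1 := Nat.sub_pos_of_lt (Nat.one_lt_pow two_ne_zero ht.one_lt)
  apply Nat.eq_of_mul_eq_mul_right h4
  rw [h1, ← sq, ← Nat.sq_sub_sq, one_pow]

lemma card_hermGenerators_through (p : ↥(hermSurf t F)) :
    #{l ∈ hermGenerators t F | p ∈ l} = t + 1 := by
  have h1 : ∑ l ∈ {l ∈ hermGenerators t F | p ∈ l}, #(l.erase p) =
      #(({x : ↥(hermSurf t F) | herm t (vec x) (vec p) = 0} : Finset _).erase p) := by
    rw [← Finset.card_biUnion]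
    · congr 1
      ext x
      simp only [Finset.mem_biUnion, Finset.mem_filter, Finset.mem_erase, Finset.mem_univ,
        true_and]
      constructor
      · rintro ⟨l, ⟨hl, hp⟩, hx, hxl⟩
        exact ⟨hx, (eq_hermLine_of_mem hF ht hl hxl hp hx).1⟩
      · rintro ⟨hx, h⟩
        obtain ⟨l, hl, hxl, hpl⟩ := coll_of_herm_eq_zero hF ht hx h
        exact ⟨l, ⟨hl, hpl⟩, hx, hxl⟩
    · intro l hl m hm hlm
      rw [Finset.mem_coe, Finset.mem_filter] at hl hm
      rw [Function.onFun, Finset.disjoint_left]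
      intro x hx hx'
      rw [Finset.mem_erase] at hx hx'
      exact hlm ((eq_hermLine_of_mem hF ht hl.1 hx.2 hl.2 hx.1).2.trans
        (eq_hermLine_of_mem hF ht hm.1 hx'.2 hm.2 hx.1).2.symm)
  rw [Finset.sum_const_nat (m := t ^ 2), Finset.card_erase_of_mem (by simp [herm_vec_self])] at h1
  · have h2 := Finset.card_filter_add_card_filter_not (s := Finset.univ)
      (fun x : ↥(hermSurf t F) => herm t (vec x) (vec p) = 0)
    rw [Finset.card_univ, card_hermSurf hF ht] at h2
    have h3 := card_herm_ne_zero hF ht p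
    have h4 : #{x : ↥(hermSurf t F) | herm t (vec x) (vec p) = 0} = (t + 1) * t ^ 2 + 1 := by
      simp only [ne_eq] at h3
      rw [h3] at h2
      linarith
    rw [h4, Nat.add_sub_cancel] at h1
    exact Nat.eq_of_mul_eq_mul_right (pow_pos (zero_lt_one.trans ht.one_lt) 2) h1
  · intro l hl
    rw [Finset.mem_filter] at hl
    obtain ⟨hl, hp⟩ := hl
    obtain ⟨a, b, hne, hab, rfl⟩ := mem_hermGenerators.1 hl
    rw [Finset.card_erase_of_mem hp, card_hermLine hF ht hne hab, Nat.add_sub_cancel]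

lemma exists_mem_coll {l : Finset ↥(hermSurf t F)} (hl : l ∈ hermGenerators t F)
    (p : ↥(hermSurf t F)) : ∃ r ∈ l, Coll (hermGenerators t F) p r := by
  by_cases hp : p ∈ l
  · exact ⟨p, hp, l, hl, hp, hp⟩
  obtain ⟨a, b, hne, hab, rfl⟩ := mem_hermGenerators.1 hl
  set v := herm t (vec b) (vec p) • vec a + (-herm t (vec a) (vec p)) • vec b with hv
  have hv0 : v ≠ 0 := by
    intro h0
    obtain ⟨h1, h2⟩ := vec_lincomb_eq_zero hne h0
    exact hp (mem_hermLine.2 ⟨(herm_eq_zero_comm hF ht).1 (neg_eq_zero.1 h2),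
      (herm_eq_zero_comm hF ht).1 h1⟩)
  have hva : herm t v (vec a) = 0 :=
    herm_lincomb_left _ _ _ _ _ (herm_vec_self a) ((herm_eq_zero_comm hF ht).1 hab)
  have hvb : herm t v (vec b) = 0 :=
    herm_lincomb_left _ _ _ _ _ hab (herm_vec_self b)
  have hvp : herm t v (vec p) = 0 := by
    rw [hv, herm_add_left, herm_smul_left, herm_smul_left]
    ring
  obtain ⟨x, c, hc, hx⟩ := exists_eq_smul_vec hv0 (herm_lincomb_right hF ht _ _ _ _ _ hva hvb)
  rw [hx, herm_smul_left, mul_eq_zero, or_iff_right hc] at hva hvb hvp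
  have hxl : x ∈ hermLine a b := mem_hermLine.2 ⟨hva, hvb⟩
  refine ⟨x, hxl, (coll_of_herm_eq_zero hF ht ?_ hvp).symm⟩
  rintro rfl
  exact hp hxl

omit hF ht

/-- The generalized quadrangle of points and generators of the Hermitian surface. -/
noncomputable def hermQuad (hF : Fintype.card F = t ^ 2) (ht : IsPrimePow t) :
    GenQuad ↥(hermSurf t F) t where
  lines := hermGenerators t F
  card_points := card_hermSurf hF ht
  card_line l hl := by
    obtain ⟨a, b, hne, hab, rfl⟩ := mem_hermGenerators.1 hl
    exact card_hermLine hF ht hne hab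
  card_pencil p := by convert card_hermGenerators_through hF ht p
  eq_of_mem l hl m hm p r hne hp hr hp' hr' :=
    (eq_hermLine_of_mem hF ht hl hp hr hne).2.trans (eq_hermLine_of_mem hF ht hm hp' hr' hne).2.symm
  exists_proj l hl p := exists_mem_coll hF ht hl p
  proj_unique l hl p hp r hr r' hr' h h' := by
    by_contra hne
    rw [(eq_hermLine_of_mem hF ht hl hr hr' hne).2] at hp
    exact hp (mem_hermLine.2 ⟨herm_eq_zero_of_coll hF ht h, herm_eq_zero_of_coll hF ht h'⟩)

include hF ht

lemma mem_perp_hermQuad {p x : ↥(hermSurf t F)} :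
    x ∈ (hermQuad hF ht).perp p ↔ herm t (vec x) (vec p) = 0 := by
  rw [GenQuad.mem_perp]
  refine ⟨fun h => herm_eq_zero_of_coll hF ht h.symm, fun h => ?_⟩
  by_cases hne : x = p
  · subst hne
    exact (hermQuad hF ht).coll_self x
  · exact (coll_of_herm_eq_zero hF ht hne h).symm

end HermitianSurface

section QuadraticForm

open scoped Classical Finset

variable {F : Type*} [Field F]

/-- A homogeneous polynomial of degree two defines a quadratic form. -/
lemma exists_quadraticForm {n : ℕ} {f : MvPolynomial (Fin n) F}
    (hf : f ∈ MvPolynomial.homogeneousSubmodule (Fin n) F 2) :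
    ∃ Q : QuadraticForm F (Fin n → F), ∀ v, Q v = MvPolynomial.eval v f := by
  have hlin : ∀ g ∈ MvPolynomial.homogeneousSubmodule (Fin n) F 1,
      ∃ φ : (Fin n → F) →ₗ[F] F, ∀ v, φ v = MvPolynomial.eval v g := by
    intro g hg
    rw [MvPolynomial.homogeneousSubmodule_one_eq_span_X] at hg
    induction hg using Submodule.span_induction with
    | mem g hg =>
      obtain ⟨i, rfl⟩ := hg
      exact ⟨LinearMap.proj i, fun v => by simp⟩
    | zero => exact ⟨0, fun v => by simp⟩
    | add g g' _ _ h h' =>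
      obtain ⟨φ, hφ⟩ := h
      obtain ⟨ψ, hψ⟩ := h'
      exact ⟨φ + ψ, fun v => by simp [hφ, hψ]⟩
    | smul a g _ h =>
      obtain ⟨φ, hφ⟩ := h
      exact ⟨a • φ, fun v => by simp [hφ]⟩
  rw [← MvPolynomial.homogeneousSubmodule_one_pow, sq] at hf
  induction hf using Submodule.mul_induction_on' with
  | mem_mul_mem g hg g' hg' =>
    obtain ⟨φ, hφ⟩ := hlin g hg
    obtain ⟨ψ, hψ⟩ := hlin g' hg'
    exact ⟨QuadraticMap.linMulLin φ ψ, fun v => by simp [hφ, hψ]⟩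
  | add g _ g' _ h h' =>
    obtain ⟨Q, hQ⟩ := h
    obtain ⟨Q', hQ'⟩ := h'
    exact ⟨Q + Q', fun v => by simp [hQ, hQ']⟩

lemma quadraticForm_lincomb {V : Type*} [AddCommGroup V] [Module F V] (Q : QuadraticForm F V)
    (a b : F) (x y : V) :
    Q (a • x + b • y) = a * a * Q x + b * b * Q y + a * b * QuadraticMap.polar Q x y := by
  rw [QuadraticMap.map_add Q, QuadraticMap.map_smul, QuadraticMap.map_smul,
    QuadraticMap.polar_smul_left, QuadraticMap.polar_smul_right]
  simp only [smul_eq_mul]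
  ring

/-- A quadratic form vanishing on a hyperplane is a product of two linear forms. -/
lemma exists_eq_mul_of_ker_le {V : Type*} [AddCommGroup V] [Module F V] (Q : QuadraticForm F V)
    {φ : V →ₗ[F] F} (hφ : φ ≠ 0) (h : ∀ x, φ x = 0 → Q x = 0) :
    ∃ ψ : V →ₗ[F] F, ∀ x, Q x = φ x * ψ x := by
  obtain ⟨w, hw⟩ : ∃ w, φ w ≠ 0 := by
    by_contra! hc
    exact hφ (LinearMap.ext hc)
  refine ⟨(φ w)⁻¹ • (Q.polarBilin w - (Q w * (φ w)⁻¹) • φ), fun x => ?_⟩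
  have h0 := h ((1 : F) • x + (-(φ x / φ w)) • w) (by
    rw [map_add, map_smul, map_smul]
    simp only [smul_eq_mul]
    field_simp
    ring)
  rw [quadraticForm_lincomb] at h0
  simp only [LinearMap.smul_apply, LinearMap.sub_apply, QuadraticMap.polarBilin_apply_apply,
    smul_eq_mul]
  rw [QuadraticMap.polar_comm] at h0
  field_simp at h0 ⊢
  linear_combination h0

end QuadraticForm

section Quadric

open scoped Classical Finset

variable {t : ℕ} {F : Type} [Field F] [Fintype F]

/-- The points of the Hermitian surface on a quadric. -/
noncomputable def zeros (t : ℕ) {F : Type} [Field F] [Fintype F]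
    (Q : QuadraticForm F (Fin 4 → F)) : Finset ↥(hermSurf t F) := {x | Q (vec x) = 0}

lemma mem_zeros {Q : QuadraticForm F (Fin 4 → F)} {x : ↥(hermSurf t F)} :
    x ∈ zeros t Q ↔ Q (vec x) = 0 := by
  simp [zeros]

variable (hF : Fintype.card F = t ^ 2) (ht : IsPrimePow t) (Q : QuadraticForm F (Fin 4 → F))

include hF

lemma exists_eq_herm (φ : (Fin 4 → F) →ₗ[F] F) : ∃ v, ∀ x, φ x = herm t x v := by
  refine ⟨fun i => φ (fun j => if i = j then 1 else 0) ^ t, fun x => ?_⟩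
  rw [LinearMap.pi_apply_eq_sum_univ φ x, herm]
  exact Finset.sum_congr rfl fun i _ => by rw [pow_pow_of_card_eq_sq hF, smul_eq_mul]

include ht

lemma eq_zero_of_hermLine_subset {p r : ↥(hermSurf t F)}
    (h : herm t (vec p) (vec r) = 0) (hsub : hermLine p r ⊆ zeros t Q) (a b : F) :
    Q (a • vec p + b • vec r) = 0 := by
  by_cases h0 : a • vec p + b • vec r = 0
  · rw [h0, map_zero]
  have h' := (herm_eq_zero_comm hF ht).1 h
  have hp : herm t (a • vec p + b • vec r) (vec p) = 0 :=
    herm_lincomb_left _ _ _ _ _ (herm_vec_self p) h'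
  have hr : herm t (a • vec p + b • vec r) (vec r) = 0 :=
    herm_lincomb_left _ _ _ _ _ h (herm_vec_self r)
  obtain ⟨x, c, hc, hx⟩ := exists_eq_smul_vec h0 (herm_lincomb_right hF ht _ _ _ _ _ hp hr)
  rw [hx, herm_smul_left, mul_eq_zero, or_iff_right hc] at hp hr
  rw [hx, QuadraticMap.map_smul, mem_zeros.1 (hsub (mem_hermLine.2 ⟨hp, hr⟩)), smul_zero]

lemma polar_eq_zero_of_hermLine_subset {p r : ↥(hermSurf t F)}
    (h : herm t (vec p) (vec r) = 0) (hsub : hermLine p r ⊆ zeros t Q) :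
    QuadraticMap.polar Q (vec p) (vec r) = 0 := by
  have h1 := eq_zero_of_hermLine_subset hF ht Q h hsub 1 1
  rw [quadraticForm_lincomb, mem_zeros.1 (hsub (left_mem_hermLine h)),
    mem_zeros.1 (hsub (right_mem_hermLine hF ht h))] at h1
  simpa using h1

lemma subset_zeros_or_card_inter_le {l : Finset ↥(hermSurf t F)} (hl : l ∈ hermGenerators t F) :
    l ⊆ zeros t Q ∨ #(zeros t Q ∩ l) ≤ 2 := by
  rw [or_iff_not_imp_right, not_le]
  intro hc
  obtain ⟨x, hx, y, hy, z, hz, hxy, hxz, hyz⟩ := Finset.two_lt_card.1 hc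
  rw [Finset.mem_inter, mem_zeros] at hx hy hz
  obtain ⟨h0, rfl⟩ := eq_hermLine_of_mem hF ht hl hx.2 hy.2 hxy
  obtain ⟨a, b, hab⟩ := (mem_hermLine_iff_exists hF ht hxy h0).1 hz.2
  have ha : a ≠ 0 := by
    rintro rfl
    exact hyz (eq_of_vec_eq_smul (a := b) (by rw [hab, zero_smul, zero_add])).symm
  have hb : b ≠ 0 := by
    rintro rfl
    exact hxz (eq_of_vec_eq_smul (a := a) (by rw [hab, zero_smul, add_zero])).symm
  have hz1 := hz.1
  rw [hab, quadraticForm_lincomb, hx.1, hy.1, mul_zero, mul_zero, zero_add, zero_add,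
    mul_eq_zero, or_iff_right (mul_ne_zero ha hb)] at hz1
  intro w hw
  obtain ⟨c, d, hcd⟩ := (mem_hermLine_iff_exists hF ht hxy h0).1 hw
  rw [mem_zeros, hcd, quadraticForm_lincomb, hx.1, hy.1, hz1]
  ring

/-- A quadric containing two generators through `p` but not the tangent plane at `p` meets this
plane in the two generators only. -/
lemma zeros_inter_perp_subset {l k : Finset ↥(hermSurf t F)} (hl : l ∈ hermGenerators t F)
    (hk : k ∈ hermGenerators t F) (hlk : l ≠ k) (hlZ : l ⊆ zeros t Q) (hkZ : k ⊆ zeros t Q)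
    {p : ↥(hermSurf t F)} (hpl : p ∈ l) (hpk : p ∈ k)
    (hp : ∃ x, herm t x (vec p) = 0 ∧ Q x ≠ 0) :
    zeros t Q ∩ (hermQuad hF ht).perp p ⊆ l ∪ k := by
  have hcard : ∀ m ∈ hermGenerators t F, 1 < #m := fun m hm => by
    rw [(hermQuad hF ht).card_line m hm]
    have := pow_pos (zero_lt_one.trans ht.one_lt) 2
    omega
  obtain ⟨e, hel, hep⟩ := Finset.exists_mem_ne (hcard l hl) p
  obtain ⟨e', hek, hep'⟩ := Finset.exists_mem_ne (hcard k hk) p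
  obtain ⟨hpe, hlpe⟩ := eq_hermLine_of_mem hF ht hl hpl hel hep.symm
  obtain ⟨hpe', hkpe⟩ := eq_hermLine_of_mem hF ht hk hpk hek hep'.symm
  subst hlpe hkpe
  have hee : herm t (vec e) (vec e') ≠ 0 := fun h => by
    have hmem : e' ∈ hermLine p e := mem_hermLine.2
      ⟨(herm_eq_zero_comm hF ht).1 hpe', (herm_eq_zero_comm hF ht).1 h⟩
    exact hlk (eq_hermLine_of_mem hF ht hl hpl hmem hep'.symm).2
  have hee' : herm t (vec e') (vec e) ≠ 0 := fun h => hee ((herm_eq_zero_comm hF ht).1 h)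
  have hdecomp : ∀ x, herm t x (vec p) = 0 →
      ∃ a b c : F, x = (1 : F) • (a • vec p + b • vec e) + c • vec e' := by
    intro x hx
    set b := herm t x (vec e') / herm t (vec e) (vec e') with hb
    set c := herm t x (vec e) / herm t (vec e') (vec e) with hc
    set y := x + (-b) • vec e + (-c) • vec e' with hy
    have hyz : ∀ z, herm t y z = herm t x z - b * herm t (vec e) z - c * herm t (vec e') z := by
      intro z
      rw [hy, herm_add_left, herm_add_left, herm_smul_left, herm_smul_left]
      ring
    have hyp : herm t y (vec p) = 0 := by
      rw [hyz, hx, (herm_eq_zero_comm hF ht).1 hpe, (herm_eq_zero_comm hF ht).1 hpe']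
      ring
    have hye : herm t y (vec e) = 0 := by
      rw [hyz, herm_vec_self, hc, div_mul_cancel₀ _ hee']
      ring
    have hye' : herm t y (vec e') = 0 := by
      rw [hyz, herm_vec_self, hb, div_mul_cancel₀ _ hee]
      ring
    obtain ⟨a, d, had⟩ := exists_lincomb_of_herm_eq_zero hF ht (linearIndependent_vec hep.symm)
      (herm_vec_self p) (herm_vec_self e) hpe hyp hye
    rw [had, herm_add_left, herm_smul_left, herm_smul_left, hpe', mul_zero, zero_add,
      mul_eq_zero, or_iff_left hee] at hye'
    refine ⟨a, b, c, ?_⟩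
    rw [hye', zero_smul, add_zero] at had
    rw [one_smul, ← had, hy, neg_smul, neg_smul]
    abel
  have hQ : ∀ a b c : F, Q ((1 : F) • (a • vec p + b • vec e) + c • vec e') =
      b * c * QuadraticMap.polar Q (vec e) (vec e') := by
    intro a b c
    rw [quadraticForm_lincomb, eq_zero_of_hermLine_subset hF ht Q hpe hlZ,
      mem_zeros.1 (hkZ hek), QuadraticMap.polar_add_left, QuadraticMap.polar_smul_left,
      QuadraticMap.polar_smul_left,
      polar_eq_zero_of_hermLine_subset hF ht Q hpe' hkZ]
    simp only [smul_eq_mul]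
    ring
  have hpol : QuadraticMap.polar Q (vec e) (vec e') ≠ 0 := fun h => by
    obtain ⟨x, hx, hQx⟩ := hp
    obtain ⟨a, b, c, rfl⟩ := hdecomp x hx
    rw [hQ, h, mul_zero] at hQx
    exact hQx rfl
  intro x hx
  rw [Finset.mem_inter, mem_zeros, mem_perp_hermQuad] at hx
  obtain ⟨a, b, c, habc⟩ := hdecomp _ hx.2
  have h0 := hx.1
  rw [habc, hQ, mul_eq_zero, or_iff_left hpol, mul_eq_zero] at h0
  rw [Finset.mem_union]
  rcases h0 with rfl | rfl
  · exact Or.inr ((mem_hermLine_iff_exists hF ht hep'.symm hpe').2 ⟨a, c, by rw [habc]; simp⟩)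
  · exact Or.inl ((mem_hermLine_iff_exists hF ht hep.symm hpe).2 ⟨a, b, by rw [habc]; simp⟩)

/-- A quadric meeting the surface in `2t³+2t²-t+1` points contains a tangent plane. -/
lemma exists_forall_eq_zero_of_card_zeros
    (hZ : #(zeros t Q) + t = 2 * t ^ 3 + 2 * t ^ 2 + 1) :
    ∃ p : ↥(hermSurf t F), ∀ x, herm t x (vec p) = 0 → Q x = 0 := by
  by_contra! hc
  exact (hermQuad hF ht).card_ne (fun m hm => subset_zeros_or_card_inter_le hF ht Q hm)
    (fun l hl k hk hlk hlZ hkZ p hpl hpk =>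
      zeros_inter_perp_subset hF ht Q hl hk hlk hlZ hkZ hpl hpk (hc p)) ht.one_lt hZ

/-- A nontangent plane contains few points of the surface. -/
lemma card_herm_eq_zero_le {v : Fin 4 → F} (hv : herm t v v ≠ 0) :
    #{x : ↥(hermSurf t F) | herm t (vec x) v = 0} ≤ t ^ 3 + 1 := by
  rw [← one_mul (t ^ 3 + 1)]
  refine (hermQuad hF ht).card_le_of_card_inter_le _ 1 fun l hl => ?_
  rw [Finset.card_le_one]
  intro x hx y hy
  rw [Finset.mem_inter, Finset.mem_filter] at hx hy
  by_contra hxy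
  obtain ⟨h, -⟩ := eq_hermLine_of_mem hF ht hl hx.2 hy.2 hxy
  have hvx := (herm_eq_zero_comm hF ht).1 hx.1.2
  have hvy := (herm_eq_zero_comm hF ht).1 hy.1.2
  obtain ⟨a, b, hab⟩ := exists_lincomb_of_herm_eq_zero hF ht (linearIndependent_vec hxy)
    (herm_vec_self x) (herm_vec_self y) h hvx hvy
  apply hv
  nth_rw 2 [hab]
  exact herm_lincomb_right hF ht _ _ _ _ _ hvx hvy

/-- A quadric meeting the surface in `2t³+2t²-t+1` points is the union of two tangent planes at
non-collinear points. -/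
lemma exists_eq_mul_herm_of_card_zeros
    (hZ : #(zeros t Q) + t = 2 * t ^ 3 + 2 * t ^ 2 + 1) :
    ∃ (a : F) (p r : ↥(hermSurf t F)), a ≠ 0 ∧ ¬ Coll (hermGenerators t F) p r ∧
      ∀ x, Q x = a * (herm t x (vec p) * herm t x (vec r)) := by
  have ht1 := ht.one_lt
  obtain ⟨p, hp⟩ := exists_forall_eq_zero_of_card_zeros hF ht Q hZ
  have hφ : hermDual t (vec p) ≠ 0 := fun h =>
    vec_ne_zero p (eq_zero_of_herm_eq_zero fun x => LinearMap.congr_fun h x)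
  obtain ⟨ψ, hψ⟩ := exists_eq_mul_of_ker_le Q hφ hp
  obtain ⟨v, hv⟩ := exists_eq_herm hF ψ
  simp only [hermDual_apply, hv] at hψ
  have hZv : zeros t Q = (hermQuad hF ht).perp p ∪
      ({x | herm t (vec x) v = 0} : Finset ↥(hermSurf t F)) := by
    ext x
    rw [mem_zeros, hψ, Finset.mem_union, mem_perp_hermQuad, mul_eq_zero, Finset.mem_filter]
    simp
  by_cases hv0 : v = 0
  · have huniv : zeros t Q = Finset.univ := by
      ext x
      simp [mem_zeros, hψ, hv0, herm, (zero_lt_one.trans ht1).ne']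
    rw [huniv, Finset.card_univ, card_hermSurf hF ht] at hZ
    nlinarith [pow_pos (zero_lt_one.trans ht1) 3, pow_pos (zero_lt_one.trans ht1) 2]
  by_cases hvv : herm t v v = 0
  · obtain ⟨r, c, hc, rfl⟩ := exists_eq_smul_vec hv0 hvv
    have hZr : zeros t Q = (hermQuad hF ht).perp p ∪ (hermQuad hF ht).perp r := by
      rw [hZv]
      congr 1
      ext x
      rw [mem_perp_hermQuad, Finset.mem_filter, herm_smul_right, mul_eq_zero,
        or_iff_right (pow_ne_zero t hc)]
      simp
    refine ⟨c ^ t, p, r, pow_ne_zero t hc, fun hcoll => ?_, fun x => ?_⟩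
    · have hcp := (hermQuad hF ht).card_perp p
      have hcr := (hermQuad hF ht).card_perp r
      rw [hZr] at hZ
      by_cases hpr : p = r
      · rw [hpr, Finset.union_self, hcr] at hZ
        nlinarith [pow_pos (zero_lt_one.trans ht1) 2]
      · have hcu := Finset.card_union_add_card_inter ((hermQuad hF ht).perp p)
          ((hermQuad hF ht).perp r)
        obtain ⟨l, hl, hpl, hrl⟩ := hcoll
        rw [(hermQuad hF ht).perp_inter_perp hl hpr hpl hrl, (hermQuad hF ht).card_line l hl,
          hcp, hcr] at hcu
        nlinarith
    · rw [hψ, herm_smul_right]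
      ring
  · have h1 := card_herm_eq_zero_le hF ht hvv
    have h2 := Finset.card_union_le ((hermQuad hF ht).perp p)
      ({x | herm t (vec x) v = 0} : Finset ↥(hermSurf t F))
    rw [(hermQuad hF ht).card_perp, ← hZv] at h2
    nlinarith

end Quadric

section MinimumWeight

open scoped Classical Finset

variable {t : ℕ} {F : Type} [Field F]

/-- The codeword defined by `a` times the product of the tangent planes at `p` and `r`. -/
noncomputable def tangentWord (d : F × ↥(hermSurf t F) × ↥(hermSurf t F)) : ↥(hermSurf t F) → F :=
  fun x => d.1 * (herm t (vec x) (vec d.2.1) * herm t (vec x) (vec d.2.2))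

lemma tangentWord_mem_hermCode (d : F × ↥(hermSurf t F) × ↥(hermSurf t F)) :
    tangentWord d ∈ hermCode t F 2 := by
  have hlin : ∀ v : Fin 4 → F, (∑ i, MvPolynomial.C (v i ^ t) * MvPolynomial.X i :
      MvPolynomial (Fin 4) F).IsHomogeneous 1 := fun v =>
    MvPolynomial.IsHomogeneous.sum _ _ _ fun i _ => MvPolynomial.isHomogeneous_C_mul_X _ i
  refine ⟨MvPolynomial.C d.1 *
    ((∑ i, MvPolynomial.C (vec d.2.1 i ^ t) * MvPolynomial.X i) *
      ∑ i, MvPolynomial.C (vec d.2.2 i ^ t) * MvPolynomial.X i), ?_, ?_⟩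
  · exact ((hlin _).mul (hlin _)).C_mul d.1
  · funext x
    simp [hermEval, tangentWord, herm, vec, mul_comm]

lemma exists_quadraticForm_of_mem_hermCode {c : ↥(hermSurf t F) → F} (hc : c ∈ hermCode t F 2) :
    ∃ Q : QuadraticForm F (Fin 4 → F), ∀ x, c x = Q (vec x) := by
  obtain ⟨f, hf, rfl⟩ := hc
  obtain ⟨Q, hQ⟩ := exists_quadraticForm hf
  exact ⟨Q, fun x => (hQ _).symm⟩

variable [Fintype F] (hF : Fintype.card F = t ^ 2) (ht : IsPrimePow t)

include hF ht

lemma wt_eq_iff (c : ↥(hermSurf t F) → F) : wt t F c = t ^ 5 - t ^ 3 - t ^ 2 + t ↔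
    #{x | c x = 0} + t = 2 * t ^ 3 + 2 * t ^ 2 + 1 := by
  have h1 := Finset.card_filter_add_card_filter_not (s := Finset.univ) (fun x => c x = 0)
  have h2 : wt t F c = #{x | ¬ c x = 0} := by
    rw [wt, Nat.card_eq_fintype_card, Fintype.card_subtype]
  have h3 : (t ^ 2 + 1) * (t ^ 3 + 1) = t ^ 5 + t ^ 3 + t ^ 2 + 1 := by ring
  have h4 : t ^ 3 + t ^ 2 ≤ t ^ 5 := by
    have := ht.one_lt
    have h5 : 2 * t ≤ t ^ 3 := by nlinarith [Nat.mul_le_mul this this]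
    calc t ^ 3 + t ^ 2 ≤ t ^ 2 * (2 * t) := by nlinarith [pow_pos (zero_lt_one.trans this) 2]
      _ ≤ t ^ 2 * t ^ 3 := Nat.mul_le_mul_left _ h5
      _ = t ^ 5 := by ring
  rw [Finset.card_univ, card_hermSurf hF ht, ← h2, h3] at h1
  omega

lemma filter_tangentWord_eq_zero {a : F} (ha : a ≠ 0) (p r : ↥(hermSurf t F)) :
    ({x | tangentWord (a, p, r) x = 0} : Finset _) =
      (hermQuad hF ht).perp p ∪ (hermQuad hF ht).perp r := by
  ext x
  rw [Finset.mem_union, mem_perp_hermQuad, mem_perp_hermQuad, Finset.mem_filter,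
    and_iff_right (Finset.mem_univ x), tangentWord, mul_eq_zero, or_iff_right ha, mul_eq_zero]

lemma wt_tangentWord {a : F} (ha : a ≠ 0) {p r : ↥(hermSurf t F)}
    (h : ¬ Coll (hermGenerators t F) p r) :
    wt t F (tangentWord (a, p, r)) = t ^ 5 - t ^ 3 - t ^ 2 + t := by
  rw [wt_eq_iff hF ht, filter_tangentWord_eq_zero hF ht ha]
  exact (hermQuad hF ht).card_perp_union_perp_of_not_coll h

lemma exists_eq_tangentWord {c : ↥(hermSurf t F) → F} (hc : c ∈ hermCode t F 2)
    (hw : wt t F c = t ^ 5 - t ^ 3 - t ^ 2 + t) :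
    ∃ (a : F) (p r : ↥(hermSurf t F)), a ≠ 0 ∧ ¬ Coll (hermGenerators t F) p r ∧
      c = tangentWord (a, p, r) := by
  obtain ⟨Q, hQ⟩ := exists_quadraticForm_of_mem_hermCode hc
  have hZ : #(zeros t Q) + t = 2 * t ^ 3 + 2 * t ^ 2 + 1 := by
    rw [← (wt_eq_iff hF ht c).1 hw]
    congr 2
    ext x
    simp [mem_zeros, hQ]
  obtain ⟨a, p, r, ha, hpr, h⟩ := exists_eq_mul_herm_of_card_zeros hF ht Q hZ
  exact ⟨a, p, r, ha, hpr, funext fun x => by rw [hQ, h, tangentWord]⟩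

lemma tangentWord_eq_iff {a a' : F} (ha : a ≠ 0) (ha' : a' ≠ 0) {p r p' r' : ↥(hermSurf t F)}
    (h : ¬ Coll (hermGenerators t F) p r) :
    tangentWord (a', p', r') = tangentWord (a, p, r) ↔
      (a', p', r') = (a, p, r) ∨ (a', p', r') = (a, r, p) := by
  have hswap : tangentWord (a, r, p) = tangentWord (a, p, r) :=
    funext fun x => by simp only [tangentWord]; ring
  refine ⟨fun heq => ?_, ?_⟩
  · have hperp : (hermQuad hF ht).perp p ∪ (hermQuad hF ht).perp r =
        (hermQuad hF ht).perp p' ∪ (hermQuad hF ht).perp r' := by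
      rw [← filter_tangentWord_eq_zero hF ht ha, ← filter_tangentWord_eq_zero hF ht ha', heq]
    have hne : p ≠ r := fun hpr => h (hpr ▸ (hermQuad hF ht).coll_self p)
    have hp := (hermQuad hF ht).mem_pair_of_perp_subset ht.one_lt
      (Finset.subset_union_left.trans hperp.subset)
    have hr := (hermQuad hF ht).mem_pair_of_perp_subset ht.one_lt
      (Finset.subset_union_right.trans hperp.subset)
    have hpair : (p' = p ∧ r' = r) ∨ (p' = r ∧ r' = p) := by
      rcases hp with rfl | rfl <;> rcases hr with rfl | rfl <;> simp_all
    have ha : ∃ x, tangentWord (a, p, r) x ≠ 0 := by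
      by_contra! h0
      have h1 := wt_tangentWord hF ht ha h
      have h2 : IsEmpty {x // tangentWord (a, p, r) x ≠ 0} := ⟨fun x => x.2 (h0 x)⟩
      rw [wt, Nat.card_of_isEmpty] at h1
      have := ht.one_lt
      omega
    obtain ⟨x, hx⟩ := ha
    have heqx := congrFun heq x
    simp only [tangentWord] at hx heqx
    rcases hpair with ⟨rfl, rfl⟩ | ⟨rfl, rfl⟩
    · left
      rw [mul_right_cancel₀ (right_ne_zero_of_mul hx) heqx]
    · right
      rw [mul_comm (herm t (vec x) (vec p'))] at heqx
      rw [mul_right_cancel₀ (right_ne_zero_of_mul hx) heqx]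
  · rintro (h | h)
    · rw [h]
    · rw [h, hswap]

lemma card_tangentWord_params :
    #(((Finset.univ : Finset F).erase 0) ×ˢ
      ({z | ¬ Coll (hermGenerators t F) z.1 z.2} : Finset (↥(hermSurf t F) × ↥(hermSurf t F)))) =
      (t ^ 2 - 1) * ((t ^ 5 + t ^ 3 + t ^ 2 + 1) * t ^ 5) := by
  rw [Finset.card_product, Finset.card_erase_of_mem (Finset.mem_univ _), Finset.card_univ, hF]
  congr 1
  rw [Finset.card_filter, Fintype.sum_prod_type]
  have h1 : ∀ p : ↥(hermSurf t F),
      (∑ r, if ¬ Coll (hermGenerators t F) p r then 1 else 0) = t ^ 5 := fun p => by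
    rw [← Finset.card_filter]
    exact (hermQuad hF ht).card_not_coll p
  rw [Finset.sum_congr rfl fun p _ => h1 p, Finset.sum_const, Finset.card_univ,
    card_hermSurf hF ht, smul_eq_mul]
  ring

end MinimumWeight

/-- The number of minimum weight codewords of `C₂(X)` equals
`(t²-1) · ½ · (t⁵+t³+t²+1) · t⁵` (stated multiplied by 2 to stay in `ℕ`). -/
theorem number_of_min_weight_codewords (t : ℕ) (ht : IsPrimePow t) (ht1 : 1 < t)
    (F : Type) [Field F] [Fintype F] (hF : Fintype.card F = t ^ 2) :
    2 * Nat.card {c : ↥(hermSurf t F) → F //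
        c ∈ hermCode t F 2 ∧ wt t F c = t ^ 5 - t ^ 3 - t ^ 2 + t} =
      (t ^ 2 - 1) * ((t ^ 5 + t ^ 3 + t ^ 2 + 1) * t ^ 5) := by
  classical
  set S : Finset (↥(hermSurf t F) → F) :=
    {c | c ∈ hermCode t F 2 ∧ wt t F c = t ^ 5 - t ^ 3 - t ^ 2 + t} with hS
  rw [Nat.card_eq_fintype_card, Fintype.card_subtype, ← card_tangentWord_params hF ht,
    Finset.card_eq_sum_card_fiberwise (f := tangentWord) (t := S), Finset.sum_const_nat (m := 2),
    mul_comm]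
  · intro c hc
    obtain ⟨hc, hw⟩ := (Finset.mem_filter.1 hc).2
    obtain ⟨a, p, r, ha, hpr, rfl⟩ := exists_eq_tangentWord hF ht hc hw
    have hne : p ≠ r := fun h => hpr (h ▸ (hermQuad hF ht).coll_self p)
    have hrp : ¬ Coll (hermGenerators t F) r p := fun h => hpr h.symm
    rw [← Finset.card_pair (a := (a, p, r)) (b := (a, r, p)) (by simp [hne])]
    congr 1
    ext ⟨a', p', r'⟩
    simp only [Finset.mem_filter, Finset.mem_product, Finset.mem_erase, Finset.mem_univ, and_true,
      true_and, Finset.mem_insert, Finset.mem_singleton]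
    constructor
    · rintro ⟨⟨ha', -⟩, h⟩
      exact (tangentWord_eq_iff hF ht ha ha' hpr).1 h
    · intro h
      have ha' : a' ≠ 0 := by
        rcases h with h | h <;> simp only [Prod.mk.injEq] at h <;> exact h.1 ▸ ha
      refine ⟨⟨ha', ?_⟩, (tangentWord_eq_iff hF ht ha ha' hpr).2 h⟩
      rcases h with h | h <;> simp only [Prod.mk.injEq] at h <;> obtain ⟨-, rfl, rfl⟩ := h
      · exact hpr
      · exact hrp
  · rintro ⟨a, p, r⟩ hd
    simp only [Finset.coe_product, Set.mem_prod, Finset.mem_coe, Finset.mem_filter,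
      Finset.mem_erase, Finset.mem_univ, and_true, true_and] at hd
    rw [Finset.mem_coe, hS, Finset.mem_filter]
    exact ⟨Finset.mem_univ _, tangentWord_mem_hermCode _, wt_tangentWord hF ht hd.1 hd.2⟩
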